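/- arXiv:1711.09858 — 2 statements merged into one kernel-verified Lean document; each statement's English description precedes it below -/
import Mathlib

section
/- Fix s ∈ (0,1). Suppose E ⊆ ℝ² is measurable and A ⊆ S¹ has positive arc-length measure, and there exists a sequence of scales r_n → 0 and C < ∞ such that ∫_A |π_θ(E(r_n))| dθ ≤ C r_n^s for all n. Then dim_H E ≤ 1 − s. -/
open MeasureTheory Metric Filter

/-- Orthogonal projection onto the line through the origin at angle θ,
identified with ℝ. -/
noncomputable def proj (θ : ℝ) (p : EuclideanSpace ℝ (Fin 2)) : ℝ :=
  p 0 * Real.cos θ + p 1 * Real.sin θ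

open Classical in
theorem greedy_weights {α ι : Type*} (F : Finset ι) (S : ι → Set α) (c : ι → ℝ)
    (hc : ∀ i ∈ F, 0 ≤ c i) (P : Finset α) (hP : ∀ p ∈ P, ∃ i ∈ F, p ∈ S i) :
    ∃ w : α → ℝ, (∀ a, 0 ≤ w a) ∧
      (∀ i ∈ F, ∑ a ∈ P, (S i).indicator w a ≤ c i) ∧
      ∀ p ∈ P, ∃ i ∈ F, p ∈ S i ∧ ∑ a ∈ P, (S i).indicator w a = c i := by
  induction P using Finset.induction_on with
  | empty => exact ⟨fun _ => 0, by simp, by simpa using hc, by simp⟩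
  | insert p P hp ih =>
    obtain ⟨w, hw0, hw1, hw2⟩ := ih (fun q hq => hP q (Finset.mem_insert_of_mem hq))
    obtain ⟨i₀, hi₀, hpi₀⟩ := hP p (Finset.mem_insert_self _ _)
    obtain ⟨j, hj, hjmin⟩ := Finset.exists_min_image (F.filter (fun i => p ∈ S i))
      (fun i => c i - ∑ a ∈ P, (S i).indicator w a) ⟨i₀, by simp [hi₀, hpi₀]⟩
    simp only [Finset.mem_filter, and_imp] at hj hjmin
    set δ := c j - ∑ a ∈ P, (S j).indicator w a with hδ
    have hδ0 : 0 ≤ δ := by linarith [hw1 j hj.1]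
    have hsum : ∀ i, ∑ a ∈ insert p P, (S i).indicator (Function.update w p δ) a
        = (if p ∈ S i then δ else 0) + ∑ a ∈ P, (S i).indicator w a := by
      intro i
      rw [Finset.sum_insert hp]
      congr 1
      · simp [Set.indicator_apply]
      · refine Finset.sum_congr rfl fun a ha => ?_
        have : a ≠ p := fun h => hp (h ▸ ha)
        simp [Set.indicator_apply, this]
    refine ⟨Function.update w p δ, ?_, ?_, ?_⟩
    · intro a
      by_cases h : a = p
      · subst h; simpa using hδ0
      · simpa [h] using hw0 a
    · intro i hi
      rw [hsum]
      split_ifs with h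
      · linarith [hjmin i hi h]
      · linarith [hw1 i hi]
    · intro q hq
      rcases Finset.mem_insert.1 hq with rfl | hq
      · exact ⟨j, hj.1, hj.2, by rw [hsum, if_pos hj.2]; linarith⟩
      · obtain ⟨i, hi, hqi, he⟩ := hw2 q hq
        refine ⟨i, hi, hqi, ?_⟩
        rw [hsum]
        split_ifs with h
        · have := hjmin i hi h
          linarith
        · linarith

theorem ennreal_two_mul_le (a b : ENNReal) : 2 * a * b ≤ a ^ 2 + b ^ 2 := by
  rcases le_total a b with h | h
  · obtain ⟨c, rfl⟩ := exists_add_of_le h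
    calc 2 * a * (a + c) ≤ 2 * a * (a + c) + c ^ 2 := le_self_add
      _ = _ := by ring
  · obtain ⟨c, rfl⟩ := exists_add_of_le h
    calc 2 * (b + c) * b ≤ 2 * (b + c) * b + c ^ 2 := le_self_add
      _ = _ := by ring

theorem ball_subset_proj_image (θ r : ℝ) (E : Set (EuclideanSpace ℝ (Fin 2)))
    (p : EuclideanSpace ℝ (Fin 2)) (hp : p ∈ E) :
    ball (proj θ p) r ⊆ proj θ '' thickening r E := by
  intro x hx
  have hx' : |x - proj θ p| < r := by simpa [Real.dist_eq] using hx
  refine ⟨p + (x - proj θ p) • !₂[Real.cos θ, Real.sin θ], ?_, ?_⟩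
  · rw [mem_thickening_iff]
    refine ⟨p, hp, ?_⟩
    have h1 : ‖(!₂[Real.cos θ, Real.sin θ] : EuclideanSpace ℝ (Fin 2))‖ = 1 := by
      simp [EuclideanSpace.norm_eq]
    rw [dist_eq_norm, add_sub_cancel_left, norm_smul, h1, mul_one]
    simpa using hx'
  · have := Real.sin_sq_add_cos_sq θ
    simp only [proj, PiLp.add_apply, PiLp.smul_apply, smul_eq_mul, Matrix.cons_val_zero, Matrix.cons_val_one]
    linear_combination (x - (p 0 * Real.cos θ + p 1 * Real.sin θ)) * this

theorem pointwise_est (θ r : ℝ) (E : Set (EuclideanSpace ℝ (Fin 2)))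
    (P : Finset (EuclideanSpace ℝ (Fin 2))) (hP : ∀ p ∈ P, p ∈ E)
    (w : EuclideanSpace ℝ (Fin 2) → ENNReal) (m : ENNReal) :
    2 * m * (ENNReal.ofReal (2 * r) * ∑ p ∈ P, w p) ≤
      m ^ 2 * volume (proj θ '' thickening r E) +
      ENNReal.ofReal (2 * r) * ∑ p ∈ P, ∑ q ∈ P, w p * w q *
        {θ : ℝ | |proj θ p - proj θ q| < 2 * r}.indicator 1 θ := by
  set B : EuclideanSpace ℝ (Fin 2) → Set ℝ := fun p => ball (proj θ p) r with hB
  have hBm : ∀ p, MeasurableSet (B p) := fun p => measurableSet_ball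
  set T : Set ℝ := ⋃ p ∈ P, B p with hT
  have hTm : MeasurableSet T := Finset.measurableSet_biUnion _ fun p _ => hBm p
  have hTS : volume T ≤ volume (proj θ '' thickening r E) :=
    measure_mono (Set.iUnion₂_subset fun p hp => ball_subset_proj_image θ r E p (hP p hp))
  set g : ℝ → ENNReal := fun x => ∑ p ∈ P, w p * (B p).indicator 1 x with hg
  have hterm : ∀ p, Measurable fun x => (B p).indicator (1 : ℝ → ENNReal) x :=
    fun p => measurable_one.indicator (hBm p)
  have hgm : Measurable g := Finset.measurable_sum _ fun p _ => (hterm p).const_mul _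
  have hpt : ∀ x, 2 * m * g x ≤ m ^ 2 * T.indicator 1 x + g x ^ 2 := by
    intro x
    by_cases hx : x ∈ T
    · simpa [hx] using ennreal_two_mul_le m (g x)
    · have : g x = 0 := by
        refine Finset.sum_eq_zero fun p hp => ?_
        have : x ∉ B p := fun h => hx (Set.mem_biUnion (Finset.mem_coe.2 hp) h)
        simp [this]
      simp [this]
  have hint1 : ∫⁻ x, g x = ENNReal.ofReal (2 * r) * ∑ p ∈ P, w p := by
    simp only [hg]
    rw [lintegral_finsetSum _ fun p _ => (hterm p).const_mul _, Finset.mul_sum]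
    refine Finset.sum_congr rfl fun p _ => ?_
    rw [lintegral_const_mul _ (hterm p), lintegral_indicator_one (hBm p), hB, Real.volume_ball, mul_comm]
  have hint2 : ∫⁻ x, g x ^ 2 ≤ ENNReal.ofReal (2 * r) * ∑ p ∈ P, ∑ q ∈ P, w p * w q *
        {θ : ℝ | |proj θ p - proj θ q| < 2 * r}.indicator 1 θ := by
    have : ∀ x, g x ^ 2 = ∑ p ∈ P, ∑ q ∈ P, (w p * w q) * (B p ∩ B q).indicator 1 x := by
      intro x
      simp only [hg, sq, Finset.sum_mul_sum]
      refine Finset.sum_congr rfl fun p _ => Finset.sum_congr rfl fun q _ => ?_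
      rw [Set.inter_indicator_one, Pi.mul_apply]; ring
    have hm2 : ∀ p q, Measurable fun x => (B p ∩ B q).indicator (1 : ℝ → ENNReal) x :=
      fun p q => measurable_one.indicator ((hBm p).inter (hBm q))
    simp only [this]
    rw [lintegral_finsetSum _ fun p _ => Finset.measurable_sum _ fun q _ => (hm2 p q).const_mul _,
      Finset.mul_sum]
    refine Finset.sum_le_sum fun p _ => ?_
    rw [lintegral_finsetSum _ fun q _ => (hm2 p q).const_mul _, Finset.mul_sum]
    refine Finset.sum_le_sum fun q _ => ?_
    rw [lintegral_const_mul _ (hm2 p q), lintegral_indicator_one ((hBm p).inter (hBm q)),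
      mul_left_comm]
    gcongr
    by_cases h : |proj θ p - proj θ q| < 2 * r
    · have : θ ∈ {θ : ℝ | |proj θ p - proj θ q| < 2 * r} := h
      rw [Set.indicator_of_mem this]
      simp only [Pi.one_apply, mul_one]
      exact (measure_mono Set.inter_subset_left).trans (by rw [hB, Real.volume_ball])
    · have : B p ∩ B q = ∅ := by
        ext x
        simp only [hB, Set.mem_inter_iff, mem_ball, Real.dist_eq, Set.mem_empty_iff_false, iff_false]
        rintro ⟨h1, h2⟩
        apply h
        have := abs_sub_le (proj θ p) x (proj θ q)
        rw [abs_sub_comm (proj θ p) x] at this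
        linarith
      simp [this]
  calc _ = ∫⁻ x, 2 * m * g x := by rw [lintegral_const_mul _ hgm, hint1]
    _ ≤ ∫⁻ x, m ^ 2 * T.indicator 1 x + g x ^ 2 := lintegral_mono hpt
    _ = m ^ 2 * volume T + ∫⁻ x, g x ^ 2 := by
      rw [lintegral_add_right _ (hgm.pow_const 2), lintegral_const_mul _ (measurable_one.indicator hTm),
        lintegral_indicator_one hTm]
    _ ≤ _ := by gcongr

theorem angle_est (v : EuclideanSpace ℝ (Fin 2)) (ε : ℝ) (hv : v ≠ 0) :
    volume ({θ : ℝ | |proj θ v| < ε} ∩ Set.Icc 0 (2 * Real.pi)) ≤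
      ENNReal.ofReal (6 * Real.pi * ε / ‖v‖) := by
  have hn : 0 < ‖v‖ := norm_pos_iff.2 hv
  set z : ℂ := ⟨v 0, v 1⟩ with hz
  have hzn : ‖z‖ = ‖v‖ := by
    rw [Complex.norm_eq_sqrt_sq_add_sq, EuclideanSpace.norm_eq]
    simp [hz]
  set φ := z.arg
  have h0 : v 0 = ‖v‖ * Real.cos φ := by
    rw [← hzn]; exact (Complex.norm_mul_cos_arg z).symm
  have h1 : v 1 = ‖v‖ * Real.sin φ := by
    rw [← hzn]; exact (Complex.norm_mul_sin_arg z).symm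
  have hproj : ∀ θ, proj θ v = ‖v‖ * Real.cos (θ - φ) := by
    intro θ
    rw [proj, Real.cos_sub, h0, h1]; ring
  have hsub : ({θ : ℝ | |proj θ v| < ε} ∩ Set.Icc 0 (2 * Real.pi)) ⊆
      ⋃ k ∈ Finset.Icc (-2 : ℤ) 3, ball (φ + (k + 1 / 2) * Real.pi) (Real.pi / 2 * ε / ‖v‖) := by
    rintro θ ⟨hθ, hθ0, hθ1⟩
    have hpi := Real.pi_pos
    have hφ1 : -Real.pi < φ := Complex.neg_pi_lt_arg z
    have hφ2 : φ ≤ Real.pi := Complex.arg_le_pi z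
    set y := (θ - φ) / Real.pi - 1 / 2 with hy
    have hyθ : θ - φ = (y + 1 / 2) * Real.pi := by rw [hy]; field_simp; ring
    have hy1 : -3/2 ≤ y := by
      by_contra! h
      nlinarith
    have hy2 : y < 5/2 := by
      by_contra! h
      nlinarith
    have hr := abs_le.1 (abs_sub_round y)
    have hk1 : (-2 : ℤ) ≤ round y := by
      have : (-3 : ℝ) < round y := by linarith
      have : (-3 : ℤ) < round y := by exact_mod_cast this
      omega
    have hk2 : round y ≤ 3 := by
      have : (round y : ℝ) < 4 := by linarith
      have : round y < 4 := by exact_mod_cast this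
      omega
    refine Set.mem_biUnion (x := round y) (by simp [hk1, hk2]) ?_
    set k := round y
    set u := (y - k) * Real.pi with hu
    have hcos : |Real.cos (θ - φ)| = |Real.sin u| := by
      have : θ - φ = u + Real.pi / 2 + k * Real.pi := by rw [hyθ, hu]; ring
      rw [this, Real.cos_add_int_mul_pi, abs_mul, abs_zpow, abs_neg, abs_one, one_zpow, one_mul,
        Real.cos_add_pi_div_two, abs_neg]
    have hu2 : |u| ≤ Real.pi / 2 := by
      rw [hu, abs_mul, abs_of_pos hpi]
      nlinarith [abs_sub_round y]
    have hsin := Real.mul_abs_le_abs_sin hu2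
    have hθ' : ‖v‖ * |Real.sin u| < ε := by
      have : |proj θ v| < ε := hθ
      rwa [hproj, abs_mul, abs_of_pos hn, hcos] at this
    rw [mem_ball, Real.dist_eq]
    have : θ - (φ + (k + 1 / 2) * Real.pi) = u := by rw [hu]; linarith
    rw [this, lt_div_iff₀ hn]
    have h3 : ‖v‖ * (2 / Real.pi * |u|) < ε := lt_of_le_of_lt (by gcongr) hθ'
    calc |u| * ‖v‖ = Real.pi / 2 * (‖v‖ * (2 / Real.pi * |u|)) := by field_simp
      _ < Real.pi / 2 * ε := by gcongr
  refine (measure_mono hsub).trans ((measure_biUnion_finset_le _ _).trans ?_)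
  simp only [Real.volume_ball, Finset.sum_const, Int.card_Icc]
  rw [nsmul_eq_mul, ← ENNReal.ofReal_natCast, ← ENNReal.ofReal_mul (by positivity)]
  apply ENNReal.ofReal_le_ofReal
  apply le_of_eq
  have h6 : (3 + 1 - (-2) : ℤ).toNat = 6 := rfl
  rw [h6]
  push_cast
  ring

theorem proj_sub (θ : ℝ) (p q : EuclideanSpace ℝ (Fin 2)) :
    proj θ p - proj θ q = proj θ (p - q) := by
  simp [proj]; ring

theorem kernel_est (p q : EuclideanSpace ℝ (Fin 2)) (r : ℝ) (hr : 0 < r) (N : ℕ)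
    (hN : dist q p ≤ 2 ^ N * r) :
    volume ({θ : ℝ | |proj θ p - proj θ q| < 2 * r} ∩ Set.Icc 0 (2 * Real.pi)) ≤
      ENNReal.ofReal (24 * Real.pi * ∑ i ∈ Finset.range (N + 1), (1 / 2) ^ i *
        (closedBall p (2 ^ i * r)).indicator 1 q) := by
  classical
  have hpi := Real.pi_pos
  have hex : ∃ i : ℕ, dist q p ≤ 2 ^ i * r := ⟨N, hN⟩
  set j := Nat.find hex with hj
  have hjs : dist q p ≤ 2 ^ j * r := Nat.find_spec hex
  have hjN : j ≤ N := Nat.find_min' hex hN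
  have hle : (1 / 2 : ℝ) ^ j ≤ ∑ i ∈ Finset.range (N + 1), (1 / 2) ^ i *
        (closedBall p (2 ^ i * r)).indicator (1 : EuclideanSpace ℝ (Fin 2) → ℝ) q := by
    have := Finset.single_le_sum (f := fun i : ℕ => (1 / 2 : ℝ) ^ i *
        (closedBall p (2 ^ i * r)).indicator (1 : EuclideanSpace ℝ (Fin 2) → ℝ) q) (s := Finset.range (N + 1))
      (fun i _ => mul_nonneg (by positivity) (Set.indicator_nonneg (by simp) _))
      (Finset.mem_range.2 (Nat.lt_succ_of_le hjN))
    refine le_trans (le_of_eq ?_) this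
    have hm : q ∈ closedBall p (2 ^ j * r) := hjs
    simp [Set.indicator_of_mem hm]
  have hmain : volume ({θ : ℝ | |proj θ p - proj θ q| < 2 * r} ∩ Set.Icc 0 (2 * Real.pi)) ≤
      ENNReal.ofReal (24 * Real.pi * (1 / 2) ^ j) := by
    rcases Nat.eq_zero_or_pos j with h0 | h0
    · refine (measure_mono Set.inter_subset_right).trans ?_
      rw [Real.volume_Icc, h0]
      apply ENNReal.ofReal_le_ofReal
      simp; linarith
    · have hlt : 2 ^ (j - 1) * r < dist q p := by
        have := Nat.find_min hex (m := j - 1) (by omega)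
        simpa using this
      have hd : 0 < dist q p := lt_of_le_of_lt (by positivity) hlt
      have hne : p - q ≠ 0 := by
        intro h
        rw [sub_eq_zero] at h
        simp [h] at hd
      simp only [proj_sub]
      refine (angle_est (p - q) (2 * r) hne).trans ?_
      apply ENNReal.ofReal_le_ofReal
      rw [← dist_eq_norm, dist_comm, div_le_iff₀ hd]
      have e : (1 / 2 : ℝ) ^ j * 2 ^ (j - 1) = 1 / 2 := by
        obtain ⟨k, hk⟩ : ∃ k, j = k + 1 := ⟨j - 1, by omega⟩
        rw [hk, Nat.add_sub_cancel, pow_succ, mul_right_comm, ← mul_pow]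
        norm_num
      calc 6 * Real.pi * (2 * r) = 24 * Real.pi * ((1 / 2 : ℝ) ^ j * 2 ^ (j - 1)) * r := by
            rw [e]; ring
        _ = 24 * Real.pi * (1 / 2) ^ j * (2 ^ (j - 1) * r) := by ring
        _ ≤ _ := by gcongr
  refine hmain.trans (ENNReal.ofReal_le_ofReal ?_)
  gcongr

theorem geom_est (t : ℝ) (ht1 : t < 1) (r : ℝ) (hr : 0 < r) (n : ℕ) :
    ∑ i ∈ Finset.range n, (1 / 2 : ℝ) ^ i * (2 ^ i * r) ^ t ≤ r ^ t * (1 - 2 ^ (t - 1))⁻¹ := by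
  have hx0 : (0 : ℝ) ≤ 2 ^ (t - 1) := by positivity
  have hx1 : (2 : ℝ) ^ (t - 1) < 1 := Real.rpow_lt_one_of_one_lt_of_neg (by norm_num) (by linarith)
  have : ∀ i : ℕ, (1 / 2 : ℝ) ^ i * (2 ^ i * r) ^ t = r ^ t * ((2 : ℝ) ^ (t - 1)) ^ i := by
    intro i
    rw [Real.mul_rpow (by positivity) hr.le, Real.rpow_sub (by norm_num), Real.rpow_one,
      div_pow, div_pow, one_pow, ← Real.rpow_natCast_mul (by norm_num), ← Real.rpow_mul_natCast (by norm_num),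
      mul_comm (i : ℝ) t]
    field_simp
  simp only [this, ← Finset.mul_sum]
  gcongr
  rw [← tsum_geometric_of_lt_one hx0 hx1]
  exact (summable_geometric_of_lt_one hx0 hx1).sum_le_tsum _ (fun i _ => by positivity)

theorem mass_est (t s : ℝ) (ht1 : t < 1) (r : ℝ) (hr : 0 < r) (N : ℕ)
    (E : Set (EuclideanSpace ℝ (Fin 2))) (A : Set ℝ) (hA2π : A ⊆ Set.Icc 0 (2 * Real.pi))
    (hA : MeasurableSet A) (a : ℝ) (ha : 0 < a) (hApos : volume A = ENNReal.ofReal a)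
    (C : ℝ) (hC : 0 ≤ C)
    (hint : ∫⁻ θ in A, volume (proj θ '' Metric.thickening r E) ≤ ENNReal.ofReal (C * r ^ s))
    (P : Finset (EuclideanSpace ℝ (Fin 2))) (hP : ∀ p ∈ P, p ∈ E)
    (hN : ∀ p ∈ P, ∀ q ∈ P, dist q p ≤ 2 ^ N * r)
    (w : EuclideanSpace ℝ (Fin 2) → ℝ) (hw0 : ∀ p, 0 ≤ w p)
    (hw : ∀ p ∈ P, ∀ i ∈ Finset.range (N + 1),
      ∑ q ∈ P, (closedBall p (2 ^ i * r)).indicator w q ≤ (2 ^ i * r) ^ t) :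
    ∑ p ∈ P, w p ≤ 24 * Real.pi * (1 - 2 ^ (t - 1))⁻¹ * C / (2 * a ^ 2) * r ^ (t + s - 1) := by
  have hpi := Real.pi_pos
  have hx1 : (2 : ℝ) ^ (t - 1) < 1 := Real.rpow_lt_one_of_one_lt_of_neg (by norm_num) (by linarith)
  set K := 24 * Real.pi * (1 - (2 : ℝ) ^ (t - 1))⁻¹ with hK
  have hKpos : 0 < K := by
    have : 0 < 1 - (2 : ℝ) ^ (t - 1) := by linarith
    positivity
  set W := ∑ p ∈ P, w p with hW
  have hW0 : 0 ≤ W := Finset.sum_nonneg fun p _ => hw0 p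
  have hrt : 0 < r ^ t := Real.rpow_pos_of_pos hr t
  have hrs : 0 < r ^ s := Real.rpow_pos_of_pos hr s
  set μ := K * r ^ t / a with hμ
  have hμ0 : 0 < μ := by positivity
  -- measurability of the angular sets
  have hmeas : ∀ p q, MeasurableSet {θ : ℝ | |proj θ p - proj θ q| < 2 * r} := by
    intro p q
    refine (isOpen_lt ?_ continuous_const).measurableSet
    unfold proj
    fun_prop
  have hind : ∀ p q, Measurable
      ({θ : ℝ | |proj θ p - proj θ q| < 2 * r}.indicator (1 : ℝ → ENNReal)) :=
    fun p q => measurable_one.indicator (hmeas p q)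
  -- the angular energy
  have henergy : ∑ p ∈ P, ∑ q ∈ P, ENNReal.ofReal (w p) * ENNReal.ofReal (w q) *
      volume ({θ : ℝ | |proj θ p - proj θ q| < 2 * r} ∩ A) ≤ ENNReal.ofReal (K * r ^ t * W) := by
    set k : EuclideanSpace ℝ (Fin 2) → EuclideanSpace ℝ (Fin 2) → ℝ := fun p q =>
      24 * Real.pi * ∑ i ∈ Finset.range (N + 1), (1 / 2) ^ i *
        (closedBall p (2 ^ i * r)).indicator 1 q with hk
    have hk0 : ∀ p q, 0 ≤ k p q := fun p q => mul_nonneg (by positivity)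
      (Finset.sum_nonneg fun i _ => mul_nonneg (by positivity) (Set.indicator_nonneg (by simp) _))
    calc _ ≤ ∑ p ∈ P, ∑ q ∈ P, ENNReal.ofReal (w p * w q * k p q) := by
          refine Finset.sum_le_sum fun p hp => Finset.sum_le_sum fun q hq => ?_
          rw [ENNReal.ofReal_mul (mul_nonneg (hw0 p) (hw0 q)), ENNReal.ofReal_mul (hw0 p)]
          gcongr
          exact (measure_mono (Set.inter_subset_inter_right _ hA2π)).trans
            (kernel_est p q r hr N (hN p hp q hq))
      _ = ENNReal.ofReal (∑ p ∈ P, w p * ∑ q ∈ P, w q * k p q) := by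
          rw [ENNReal.ofReal_sum_of_nonneg fun p _ => mul_nonneg (hw0 p)
            (Finset.sum_nonneg fun q _ => mul_nonneg (hw0 q) (hk0 p q))]
          refine Finset.sum_congr rfl fun p _ => ?_
          rw [Finset.mul_sum, ENNReal.ofReal_sum_of_nonneg fun q _ => mul_nonneg (hw0 p)
            (mul_nonneg (hw0 q) (hk0 p q))]
          simp only [mul_assoc]
      _ ≤ _ := by
          apply ENNReal.ofReal_le_ofReal
          rw [mul_comm, hW, Finset.sum_mul]
          refine Finset.sum_le_sum fun p hp => ?_
          refine mul_le_mul_of_nonneg_left ?_ (hw0 p)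
          calc ∑ q ∈ P, w q * k p q = 24 * Real.pi * ∑ i ∈ Finset.range (N + 1), (1 / 2) ^ i *
                ∑ q ∈ P, (closedBall p (2 ^ i * r)).indicator w q := by
                simp only [hk, Finset.mul_sum]
                rw [Finset.sum_comm]
                refine Finset.sum_congr rfl fun i _ => Finset.sum_congr rfl fun q _ => ?_
                by_cases h : q ∈ closedBall p (2 ^ i * r)
                · rw [Set.indicator_of_mem h, Set.indicator_of_mem h, Pi.one_apply]; ring
                · rw [Set.indicator_of_notMem h, Set.indicator_of_notMem h]; ring
            _ ≤ 24 * Real.pi * ∑ i ∈ Finset.range (N + 1), (1 / 2) ^ i * (2 ^ i * r) ^ t := by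
                gcongr with i hi
                exact hw p hp i hi
            _ ≤ 24 * Real.pi * (r ^ t * (1 - 2 ^ (t - 1))⁻¹) := by
                gcongr
                exact geom_est t ht1 r hr _
            _ = _ := by rw [hK]; ring
  have hsumW : ∑ p ∈ P, ENNReal.ofReal (w p) = ENNReal.ofReal W :=
    (ENNReal.ofReal_sum_of_nonneg fun p _ => hw0 p).symm
  have hI : ENNReal.ofReal (2 * μ * (2 * r * W) * a) ≤
      ENNReal.ofReal (μ ^ 2 * (C * r ^ s) + 2 * r * (K * r ^ t * W)) := by
    calc ENNReal.ofReal (2 * μ * (2 * r * W) * a)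
        = ∫⁻ θ in A, 2 * ENNReal.ofReal μ *
            (ENNReal.ofReal (2 * r) * ∑ p ∈ P, ENNReal.ofReal (w p)) := by
          rw [setLIntegral_const, hApos, hsumW, ENNReal.ofReal_mul (by positivity),
            ENNReal.ofReal_mul (by positivity), ENNReal.ofReal_mul (by positivity),
            ENNReal.ofReal_mul (p := 2 * r) (by positivity)]
          simp
      _ ≤ ∫⁻ θ in A, (ENNReal.ofReal μ ^ 2 * volume (proj θ '' thickening r E) +
            ENNReal.ofReal (2 * r) * ∑ p ∈ P, ∑ q ∈ P,
              ENNReal.ofReal (w p) * ENNReal.ofReal (w q) *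
              {θ : ℝ | |proj θ p - proj θ q| < 2 * r}.indicator 1 θ) :=
          lintegral_mono fun θ => pointwise_est θ r E P hP (fun p => ENNReal.ofReal (w p)) _
      _ = ENNReal.ofReal μ ^ 2 * (∫⁻ θ in A, volume (proj θ '' thickening r E)) +
            ENNReal.ofReal (2 * r) * ∑ p ∈ P, ∑ q ∈ P,
              ENNReal.ofReal (w p) * ENNReal.ofReal (w q) *
              volume ({θ : ℝ | |proj θ p - proj θ q| < 2 * r} ∩ A) := by
          rw [lintegral_add_right, lintegral_const_mul', lintegral_const_mul,
            lintegral_finsetSum]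
          · congr 2
            refine Finset.sum_congr rfl fun p _ => ?_
            rw [lintegral_finsetSum]
            · refine Finset.sum_congr rfl fun q _ => ?_
              rw [lintegral_const_mul _ (hind p q), lintegral_indicator_one (hmeas p q),
                Measure.restrict_apply (hmeas p q)]
            · exact fun q _ => (hind p q).const_mul _
          · exact fun p _ => Finset.measurable_sum _ fun q _ => (hind p q).const_mul _
          · exact Finset.measurable_sum _ fun p _ =>
              Finset.measurable_sum _ fun q _ => (hind p q).const_mul _
          · finiteness
          · exact (Finset.measurable_sum _ fun p _ =>
              Finset.measurable_sum _ fun q _ => (hind p q).const_mul _).const_mul _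
      _ ≤ ENNReal.ofReal μ ^ 2 * ENNReal.ofReal (C * r ^ s) +
            ENNReal.ofReal (2 * r) * ENNReal.ofReal (K * r ^ t * W) := by gcongr
      _ = _ := by
          rw [← ENNReal.ofReal_pow hμ0.le, ← ENNReal.ofReal_mul (by positivity),
            ← ENNReal.ofReal_mul (by positivity), ← ENNReal.ofReal_add (by positivity) (by positivity)]
  rw [ENNReal.ofReal_le_ofReal_iff (by positivity)] at hI
  have hμa : μ * a = K * r ^ t := by rw [hμ]; field_simp
  have h2 : 2 * (K * r ^ t) * r * W ≤ μ ^ 2 * (C * r ^ s) := by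
    have : 2 * μ * (2 * r * W) * a = 4 * (K * r ^ t) * r * W := by rw [← hμa]; ring
    linarith
  have h3 : μ ^ 2 * (C * r ^ s) = 2 * (K * r ^ t) * r * (K * C / (2 * a ^ 2) * r ^ (t + s - 1)) := by
    rw [Real.rpow_sub hr, Real.rpow_add hr, Real.rpow_one, hμ]
    field_simp
  rw [h3] at h2
  exact le_of_mul_le_mul_left h2 (by positivity)

theorem cover_est (t s : ℝ) (ht1 : t < 1) (r : ℝ) (hr : 0 < r)
    (E : Set (EuclideanSpace ℝ (Fin 2))) (hEb : Bornology.IsBounded E)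
    (A : Set ℝ) (hA2π : A ⊆ Set.Icc 0 (2 * Real.pi))
    (hA : MeasurableSet A) (a : ℝ) (ha : 0 < a) (hApos : volume A = ENNReal.ofReal a)
    (C : ℝ) (hC : 0 ≤ C)
    (hint : ∫⁻ θ in A, volume (proj θ '' Metric.thickening r E) ≤ ENNReal.ofReal (C * r ^ s)) :
    ∃ u : Finset (EuclideanSpace ℝ (Fin 2) × ℕ),
      E ⊆ (⋃ b : u, closedBall b.1.1 (6 * (2 ^ b.1.2 * r))) ∧
      ∑ b ∈ u, (2 ^ b.2 * r) ^ t ≤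
        24 * Real.pi * (1 - 2 ^ (t - 1))⁻¹ * C / (2 * a ^ 2) * r ^ (t + s - 1) := by
  classical
  have htb : TotallyBounded E := hEb.isCompact_closure.totallyBounded.subset subset_closure
  obtain ⟨P', hP'E, hP'fin, hP'cov⟩ := finite_approx_of_totallyBounded htb r hr
  set P := hP'fin.toFinset with hPdef
  have hPE : ∀ p ∈ P, p ∈ E := fun p hp => hP'E (by simpa [hPdef] using hp)
  obtain ⟨N, hN⟩ : ∃ N : ℕ, diam E / r < 2 ^ N := pow_unbounded_of_one_lt _ (by norm_num)
  have hN' : ∀ p ∈ P, ∀ q ∈ P, dist q p ≤ 2 ^ N * r := fun p hp q hq =>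
    (dist_le_diam_of_mem hEb (hPE q hq) (hPE p hp)).trans ((div_lt_iff₀ hr).1 hN).le
  obtain ⟨w, hw0, hw1, hw2⟩ := greedy_weights (P ×ˢ Finset.range (N + 1))
    (fun b => closedBall b.1 (2 ^ b.2 * r)) (fun b => (2 ^ b.2 * r) ^ t)
    (fun b _ => by positivity) P
    (fun p hp => ⟨(p, 0), by simp [hp], by simp [hr.le]⟩)
  have hmass := mass_est t s ht1 r hr N E A hA2π hA a ha hApos C hC hint P hPE hN' w hw0
    (fun p hp i hi => hw1 (p, i) (Finset.mk_mem_product hp hi))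
  set F := P ×ˢ Finset.range (N + 1) with hF
  set T : Finset (EuclideanSpace ℝ (Fin 2) × ℕ) := F.filter (fun b =>
    ∑ x ∈ P, (closedBall b.1 (2 ^ b.2 * r)).indicator w x = (2 ^ b.2 * r) ^ t) with hT
  obtain ⟨u, huT, hdisj, hucov⟩ := Vitali.exists_disjoint_subfamily_covering_enlargement_closedBall
    (T : Set (EuclideanSpace ℝ (Fin 2) × ℕ)) (fun b => b.1) (fun b => 2 ^ b.2 * r) (2 ^ N * r)
    (fun b hb => by
      have hb' : b ∈ F := (Finset.mem_filter.1 (Finset.mem_coe.1 hb)).1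
      have : b.2 ≤ N := by
        have := Finset.mem_range.1 (Finset.mem_product.1 hb').2
        omega
      gcongr
      norm_num) 5 (by norm_num)
  have hufin : u.Finite := T.finite_toSet.subset huT
  refine ⟨hufin.toFinset, ?_, ?_⟩
  · intro x hx
    obtain ⟨p, hp, hxp⟩ := Set.mem_iUnion₂.1 (hP'cov hx)
    obtain ⟨b, hbF, hpb, hbt⟩ := hw2 p (by simpa [hPdef] using hp)
    obtain ⟨c, hcu, hbc⟩ := hucov b (by simp only [hT, Finset.coe_filter]; exact ⟨hbF, hbt⟩)
    refine Set.mem_iUnion.2 ⟨⟨c, hufin.mem_toFinset.2 hcu⟩, ?_⟩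
    have h1 : dist p c.1 ≤ 5 * (2 ^ c.2 * r) := hbc hpb
    have h2 : dist x p < r := hxp
    have h3 : r ≤ 2 ^ c.2 * r := le_mul_of_one_le_left hr.le (one_le_pow₀ (by norm_num))
    have := dist_triangle x p c.1
    rw [mem_closedBall]
    linarith
  · refine le_trans ?_ hmass
    calc ∑ b ∈ hufin.toFinset, (2 ^ b.2 * r) ^ t
        = ∑ b ∈ hufin.toFinset, ∑ x ∈ P, (closedBall b.1 (2 ^ b.2 * r)).indicator w x := by
          refine Finset.sum_congr rfl fun b hb => ?_
          exact (Finset.mem_filter.1 (Finset.mem_coe.1 (huT (hufin.mem_toFinset.1 hb)))).2.symm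
      _ = ∑ x ∈ P, ∑ b ∈ hufin.toFinset, (closedBall b.1 (2 ^ b.2 * r)).indicator w x :=
          Finset.sum_comm
      _ ≤ ∑ x ∈ P, w x := by
          refine Finset.sum_le_sum fun x _ => ?_
          by_cases h : ∃ b ∈ hufin.toFinset, x ∈ closedBall b.1 (2 ^ b.2 * r)
          · obtain ⟨b, hb, hxb⟩ := h
            rw [Finset.sum_eq_single_of_mem b hb, Set.indicator_of_mem hxb]
            intro c hc hcb
            refine Set.indicator_of_notMem (fun hxc => ?_) _
            exact Set.disjoint_left.1 (hdisj (hufin.mem_toFinset.1 hc) (hufin.mem_toFinset.1 hb) hcb)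
              hxc hxb
          · push Not at h
            rw [Finset.sum_eq_zero fun b hb => Set.indicator_of_notMem (h b hb) _]
            exact hw0 x

theorem dimH_bounded (s t : ℝ) (ht0 : 0 < t) (hst : 1 - s < t) (ht1 : t < 1)
    (E : Set (EuclideanSpace ℝ (Fin 2))) (hEb : Bornology.IsBounded E)
    (A : Set ℝ) (hA : MeasurableSet A) (hA2π : A ⊆ Set.Icc 0 (2 * Real.pi))
    (hApos : 0 < volume A)
    (r : ℕ → ℝ) (hrpos : ∀ n, 0 < r n) (hr0 : Tendsto r atTop (nhds 0))
    (C : ℝ) (hC : 0 ≤ C)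
    (hint : ∀ n, ∫⁻ θ in A, volume (proj θ '' Metric.thickening (r n) E)
      ≤ ENNReal.ofReal (C * r n ^ s)) :
    dimH E ≤ ENNReal.ofReal t := by
  have hAfin : volume A ≠ ⊤ := ((measure_mono hA2π).trans_lt (by rw [Real.volume_Icc]; exact ENNReal.ofReal_lt_top)).ne
  set a := (volume A).toReal with ha
  have hapos : 0 < a := ENNReal.toReal_pos hApos.ne' hAfin
  have haA : volume A = ENNReal.ofReal a := (ENNReal.ofReal_toReal hAfin).symm
  choose u hucov husum using fun n => cover_est t s ht1 (r n) (hrpos n) E hEb A hA2π hA a hapos haA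
    C hC (hint n)
  set M := 24 * Real.pi * (1 - 2 ^ (t - 1))⁻¹ * C / (2 * a ^ 2) with hM
  set B : ℕ → ℝ := fun n => M * r n ^ (t + s - 1) with hB
  have hBlim : Tendsto B atTop (nhds 0) := by
    have h1 : Tendsto (fun n => r n ^ (t + s - 1)) atTop (nhds (0 ^ (t + s - 1))) :=
      hr0.rpow_const (Or.inr (by linarith))
    rw [Real.zero_rpow (by linarith)] at h1
    simpa using h1.const_mul M
  have hB0 : ∀ n, 0 ≤ B n := fun n =>
    (Finset.sum_nonneg fun b _ => Real.rpow_nonneg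
      (mul_nonneg (by positivity) (hrpos n).le) _).trans (husum n)
  have hrad : ∀ n (b : u n), 2 ^ b.1.2 * r n ≤ B n ^ t⁻¹ := by
    intro n b
    have hp : 0 < 2 ^ b.1.2 * r n := mul_pos (by positivity) (hrpos n)
    have h1 : (2 ^ b.1.2 * r n) ^ t ≤ B n :=
      (Finset.single_le_sum (f := fun b : EuclideanSpace ℝ (Fin 2) × ℕ => (2 ^ b.2 * r n) ^ t)
        (fun b _ => Real.rpow_nonneg (mul_nonneg (by positivity) (hrpos n).le) _) b.2).trans (husum n)
    rwa [Real.le_rpow_inv_iff_of_pos hp.le (hB0 n) ht0]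
  have hdiam : ∀ n (b : u n), ediam (closedBall b.1.1 (6 * (2 ^ b.1.2 * r n))) ≤
      ENNReal.ofReal (12 * (2 ^ b.1.2 * r n)) := by
    intro n b
    have hp : 0 < 2 ^ b.1.2 * r n := mul_pos (by positivity) (hrpos n)
    refine ediam_le fun x hx y hy => ?_
    rw [edist_dist]
    apply ENNReal.ofReal_le_ofReal
    have := dist_triangle_right x y b.1.1
    rw [mem_closedBall] at hx hy
    linarith
  have hmu := Measure.hausdorffMeasure_le_liminf_sum (ι := fun n => u n) t E (l := atTop)
    (fun n => ENNReal.ofReal (12 * B n ^ t⁻¹))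
    (by
      have h1 : Tendsto (fun n => B n ^ t⁻¹) atTop (nhds (0 ^ t⁻¹)) :=
        hBlim.rpow_const (Or.inr (by positivity))
      rw [Real.zero_rpow (by positivity)] at h1
      have := ENNReal.tendsto_ofReal (h1.const_mul 12)
      simpa using this)
    (fun n b => closedBall b.1.1 (6 * (2 ^ b.1.2 * r n)))
    (Eventually.of_forall fun n b => (hdiam n b).trans
      (ENNReal.ofReal_le_ofReal (by gcongr; exact hrad n b)))
    (Eventually.of_forall hucov)
  have hlim : Tendsto (fun n => ∑ b : u n, ediam (closedBall b.1.1 (6 * (2 ^ b.1.2 * r n))) ^ t)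
      atTop (nhds 0) := by
    have hup : Tendsto (fun n => ENNReal.ofReal (12 ^ t * B n)) atTop (nhds 0) := by
      have := ENNReal.tendsto_ofReal (hBlim.const_mul (12 ^ t))
      simpa using this
    refine tendsto_of_tendsto_of_tendsto_of_le_of_le tendsto_const_nhds hup
      (fun n => zero_le) (fun n => ?_)
    calc ∑ b : u n, ediam (closedBall b.1.1 (6 * (2 ^ b.1.2 * r n))) ^ t
        ≤ ∑ b : u n, ENNReal.ofReal (12 ^ t * (2 ^ b.1.2 * r n) ^ t) := by
          refine Finset.sum_le_sum fun b _ => ?_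
          have hp : 0 < 2 ^ b.1.2 * r n := mul_pos (by positivity) (hrpos n)
          rw [← Real.mul_rpow (by norm_num) hp.le, ← ENNReal.ofReal_rpow_of_pos (by positivity)]
          gcongr
          exact hdiam n b
      _ = ∑ b ∈ u n, ENNReal.ofReal (12 ^ t * (2 ^ b.2 * r n) ^ t) :=
          Finset.sum_coe_sort (u n) (fun b => ENNReal.ofReal (12 ^ t * (2 ^ b.2 * r n) ^ t))
      _ = ENNReal.ofReal (12 ^ t * ∑ b ∈ u n, (2 ^ b.2 * r n) ^ t) := by
          rw [Finset.mul_sum, ENNReal.ofReal_sum_of_nonneg]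
          intro b _
          exact mul_nonneg (by positivity)
            (Real.rpow_nonneg (mul_nonneg (by positivity) (hrpos n).le) _)
      _ ≤ _ := ENNReal.ofReal_le_ofReal (by gcongr; exact husum n)
  rw [hlim.liminf_eq] at hmu
  have : dimH E ≤ (t.toNNReal : ENNReal) := by
    apply dimH_le_of_hausdorffMeasure_ne_top
    rw [Real.coe_toNNReal t ht0.le]
    exact (hmu.trans_lt (by simp)).ne
  exact this

/-- If the integral over a set A of angles of positive measure of the lengths
of projections of the rₙ-neighborhoods of E decays like C rₙ^s along a
sequence rₙ → 0, then dim_H E ≤ 1 - s. -/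
theorem dimH_le_of_favard_decay (s : ℝ) (hs : s ∈ Set.Ioo (0:ℝ) 1)
    (E : Set (EuclideanSpace ℝ (Fin 2))) (hE : MeasurableSet E)
    (A : Set ℝ) (hA : MeasurableSet A) (hA2π : A ⊆ Set.Icc 0 (2 * Real.pi))
    (hApos : 0 < volume A)
    (r : ℕ → ℝ) (hrpos : ∀ n, 0 < r n) (hr0 : Tendsto r atTop (nhds 0))
    (C : ℝ) (hC : 0 ≤ C)
    (hint : ∀ n, ∫⁻ θ in A, volume (proj θ '' Metric.thickening (r n) E)
      ≤ ENNReal.ofReal (C * r n ^ s)) :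
    dimH E ≤ ENNReal.ofReal (1 - s) := by
  obtain ⟨hs0, hs1⟩ := hs
  have key : ∀ t, 1 - s < t → t < 1 → dimH E ≤ ENNReal.ofReal t := by
    intro t ht ht1
    have hEU : E = ⋃ k : ℕ, E ∩ closedBall 0 k := by
      rw [← Set.inter_iUnion, iUnion_closedBall_nat, Set.inter_univ]
    rw [hEU, dimH_iUnion]
    refine iSup_le fun k => ?_
    refine dimH_bounded s t (by linarith) ht ht1 _ (isBounded_closedBall.subset Set.inter_subset_right)
      A hA hA2π hApos r hrpos hr0 C hC (fun n => le_trans ?_ (hint n))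
    refine lintegral_mono fun θ => measure_mono (Set.image_mono ?_)
    exact thickening_subset_of_subset _ Set.inter_subset_left
  have hlim : Tendsto (fun t : ℝ => ENNReal.ofReal t) (nhdsWithin (1 - s) (Set.Ioi (1 - s)))
      (nhds (ENNReal.ofReal (1 - s))) :=
    (ENNReal.continuous_ofReal.tendsto _).mono_left nhdsWithin_le_nhds
  refine ge_of_tendsto hlim ?_
  filter_upwards [Ioo_mem_nhdsGT (show 1 - s < 1 by linarith)] with t ht
  exact key t ht.1 ht.2
end

section
/- For almost every θ ∈ [0, 2π], the Hausdorff dimension of π_θ E equals min(dim_H E, 1), where E ⊆ ℝ² is any Borel set. -/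
open MeasureTheory

open Set Filter Topology
open scoped ENNReal NNReal

namespace Marstrand

section Content

variable {X ι : Type*}

/-- Cost of the cheapest cover by cells. -/
noncomputable def coverCost (cell : ι → Set X) (w : ι → ℝ≥0∞) (A : Set X) : ℝ≥0∞ :=
  ⨅ (C : Set ι) (_ : A ⊆ ⋃ q ∈ C, cell q), ∑' q : C, w q

/-- Hausdorff content relative to a family of cells. -/
noncomputable def content (cell : ι → Set X) (w : ι → ℝ≥0∞) : OuterMeasure X :=
  OuterMeasure.ofFunction (coverCost cell w) (by
    refine le_antisymm ?_ bot_le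
    refine iInf_le_of_le ∅ (iInf_le_of_le (by simp) (by simp)))

variable {cell : ι → Set X} {w : ι → ℝ≥0∞}

lemma content_le {A : Set X} {C : Set ι} (h : A ⊆ ⋃ q ∈ C, cell q) :
    content cell w A ≤ ∑' q : C, w q :=
  (OuterMeasure.ofFunction_le A).trans (iInf_le_of_le C (iInf_le _ h))

lemma content_cell_le (q : ι) : content cell w (cell q) ≤ w q := by
  have := content_le (w := w) (cell := cell) (A := cell q) (C := {q}) (by simp)
  simpa using this

lemma exists_cover {A : Set X} {c : ℝ≥0∞} (h : content cell w A < c) :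
    ∃ C : Set ι, A ⊆ (⋃ q ∈ C, cell q) ∧ ∑' q : C, w q < c := by
  rw [content, OuterMeasure.ofFunction_apply] at h
  simp only [iInf_lt_iff] at h
  obtain ⟨t, ht, hs⟩ := h
  obtain ⟨e, he, hes⟩ := ENNReal.exists_pos_sum_of_countable' (tsub_pos_of_lt hs).ne' ℕ
  have hfin : ∀ n, coverCost cell w (t n) ≠ ∞ := fun n =>
    ((ENNReal.le_tsum n).trans_lt hs).ne_top
  have : ∀ n, ∃ C : Set ι, t n ⊆ (⋃ q ∈ C, cell q) ∧
      ∑' q : C, w q < coverCost cell w (t n) + e n := by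
    intro n
    have h1 : coverCost cell w (t n) < coverCost cell w (t n) + e n :=
      ENNReal.lt_add_right (hfin n) (he n).ne'
    conv_lhs at h1 => rw [coverCost]
    simp only [iInf_lt_iff] at h1
    obtain ⟨C, h2, h3⟩ := h1
    exact ⟨C, h2, h3⟩
  choose C hC1 hC2 using this
  refine ⟨⋃ n, C n, ?_, ?_⟩
  · intro x hx
    obtain ⟨n, hn⟩ := mem_iUnion.1 (ht hx)
    have := hC1 n hn
    simp only [mem_iUnion, exists_prop] at this ⊢
    obtain ⟨q, hq, hx⟩ := this
    exact ⟨q, ⟨n, hq⟩, hx⟩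
  · calc ∑' q : (⋃ n, C n), w q ≤ ∑' n, ∑' q : C n, w q := ENNReal.tsum_iUnion_le_tsum _ _
      _ ≤ ∑' n, (coverCost cell w (t n) + e n) := ENNReal.tsum_le_tsum fun n => (hC2 n).le
      _ = ∑' n, coverCost cell w (t n) + ∑' n, e n := ENNReal.tsum_add
      _ < c := by
        have := ENNReal.add_lt_add_left (a := ∑' n, coverCost cell w (t n)) hs.ne_top hes
        rwa [add_tsub_cancel_of_le hs.le] at this

variable (cell) in
/-- Maximal cells of a family. -/
def maxCells (lev : ι → ℕ) (S : Set ι) : Set ι :=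
  {q ∈ S | ¬ ∃ p ∈ S, lev p < lev q ∧ cell q ⊆ cell p}

lemma mem_maxCells_cover {lev : ι → ℕ} {S : Set ι} {x : X} {q : ι} (hq : q ∈ S) (hx : x ∈ cell q) :
    ∃ p ∈ maxCells cell lev S, x ∈ cell p := by
  classical
  have h : ∃ n, ∃ p ∈ S, x ∈ cell p ∧ lev p = n := ⟨_, q, hq, hx, rfl⟩
  obtain ⟨p, hp, hxp, hl⟩ := Nat.find_spec h
  refine ⟨p, ⟨hp, ?_⟩, hxp⟩
  rintro ⟨p', hp', hlt, hsub⟩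
  exact Nat.find_min h (hl ▸ hlt) ⟨p', hp', hsub hxp, rfl⟩

lemma content_iUnion_le {lev : ι → ℕ}
    (hlam : ∀ p q x, x ∈ cell p → x ∈ cell q → lev p ≤ lev q →
      p = q ∨ (lev p < lev q ∧ cell q ⊆ cell p))
    {A : ℕ → Set X} (hA : Monotone A) {c : ℝ≥0∞} (hc : c ≠ ∞)
    (h : ∀ n, content cell w (A n) ≤ c) : content cell w (⋃ n, A n) ≤ c := by
  classical
  refine ENNReal.le_of_forall_pos_le_add fun ε hε _ => ?_
  obtain ⟨e, he, hes⟩ := ENNReal.exists_pos_sum_of_countable'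
    (ENNReal.coe_pos.2 hε).ne' ℕ
  have hfin : ∀ n, content cell w (A n) ≠ ∞ := fun n => ((h n).trans_lt hc.lt_top).ne
  have : ∀ n, ∃ C : Set ι, A n ⊆ (⋃ q ∈ C, cell q) ∧
      ∑' q : C, w q < content cell w (A n) + e n := fun n =>
    exists_cover (ENNReal.lt_add_right (hfin n) (he n).ne')
  choose C hC1 hC2 using this
  let S : ℕ → Set ι := fun N => ⋃ n ≤ N, C n
  let D : ℕ → Set ι := fun N => maxCells cell lev (S N)
  have hCS : ∀ {n N}, n ≤ N → C n ⊆ S N := fun {n N} hn q hq => by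
    simp only [S, mem_iUnion]; exact ⟨n, hn, hq⟩
  have hSS : ∀ {n N}, n ≤ N → S n ⊆ S N := fun {n N} hn q hq => by
    simp only [S, mem_iUnion] at hq ⊢
    obtain ⟨i, hi, hq⟩ := hq
    exact ⟨i, hi.trans hn, hq⟩
  have key : ∀ N, ∑' q : D N, w q ≤ content cell w (A N) + ∑ n ∈ Finset.range (N + 1), e n := by
    intro N
    induction N with
    | zero =>
      simp only [zero_add, Finset.range_one, Finset.sum_singleton]
      refine le_trans (ENNReal.tsum_mono_subtype _ ?_) (hC2 0).le
      intro q hq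
      have := hq.1
      simp only [S, mem_iUnion] at this
      obtain ⟨i, hi, hq⟩ := this
      obtain rfl : i = 0 := by omega
      exact hq
    | succ N ih =>
      let T : Set ι := D N ∪ C (N + 1)
      let M' : Set ι := (D N ∩ C (N + 1)) ∪ {q ∈ T | ∃ p ∈ T, lev p < lev q ∧ cell q ⊆ cell p}
      have hM : D (N + 1) ⊆ maxCells cell lev T := by
        rintro q ⟨hq, hmax⟩
        have hTS : T ⊆ S (N + 1) := union_subset (fun r hr => hSS (Nat.le_succ N) hr.1)
          (hCS le_rfl)
        refine ⟨?_, fun ⟨p, hp, hh⟩ => hmax ⟨p, hTS hp, hh⟩⟩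
        simp only [S, mem_iUnion] at hq
        obtain ⟨i, hi, hq⟩ := hq
        rcases Nat.lt_or_ge N i with hlt | hle
        · obtain rfl : i = N + 1 := by omega
          exact Or.inr hq
        · exact Or.inl ⟨hCS hle hq, fun ⟨p, hp, hh⟩ => hmax ⟨p, hSS (Nat.le_succ N) hp, hh⟩⟩
      have hcov : A N ⊆ ⋃ q ∈ M', cell q := by
        intro x hx
        have h1 := hC1 N hx
        have h2 := hC1 (N + 1) (hA (Nat.le_succ N) hx)
        simp only [mem_iUnion, exists_prop] at h1 h2 ⊢
        obtain ⟨p0, hp0, hxp0⟩ := h1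
        obtain ⟨q, hq, hxq⟩ := h2
        obtain ⟨p, hp, hxp⟩ := mem_maxCells_cover (lev := lev) (hCS le_rfl hp0) hxp0
        rcases le_total (lev p) (lev q) with hl | hl
        · rcases hlam p q x hxp hxq hl with rfl | hh
          · exact ⟨p, Or.inl ⟨hp, hq⟩, hxp⟩
          · exact ⟨q, Or.inr ⟨Or.inr hq, p, Or.inl hp, hh⟩, hxq⟩
        · rcases hlam q p x hxq hxp hl with rfl | hh
          · exact ⟨q, Or.inl ⟨hp, hq⟩, hxp⟩
          · exact ⟨p, Or.inr ⟨Or.inl hp, q, Or.inr hq, hh⟩, hxp⟩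
      have hsum : ∑' q : maxCells cell lev T, w q + ∑' q : M', w q
          ≤ ∑' q : D N, w q + ∑' q : C (N + 1), w q := by
        simp only [tsum_subtype]
        rw [← ENNReal.tsum_add, ← ENNReal.tsum_add]
        refine ENNReal.tsum_le_tsum fun q => ?_
        by_cases h1 : q ∈ D N <;> by_cases h2 : q ∈ C (N + 1)
        · rw [indicator_of_mem h1, indicator_of_mem h2]
          exact add_le_add (indicator_le_self' (fun _ _ => zero_le) _)
            (indicator_le_self' (fun _ _ => zero_le) _)
        · rw [indicator_of_mem h1, indicator_of_notMem h2]
          by_cases h3 : ∃ p ∈ T, lev p < lev q ∧ cell q ⊆ cell p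
          · rw [indicator_of_notMem (fun hh => hh.2 h3), zero_add, add_zero]
            exact indicator_le_self' (fun _ _ => zero_le) _
          · rw [indicator_of_notMem (s := M')]
            · exact add_le_add (indicator_le_self' (fun _ _ => zero_le) _) le_rfl
            · rintro (hh | hh)
              · exact h2 hh.2
              · exact h3 hh.2
        · rw [indicator_of_mem h2, indicator_of_notMem h1]
          by_cases h3 : ∃ p ∈ T, lev p < lev q ∧ cell q ⊆ cell p
          · rw [indicator_of_notMem (fun hh => hh.2 h3)]
            exact add_le_add le_rfl (indicator_le_self' (fun _ _ => zero_le) _) 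
          · rw [indicator_of_notMem (s := M'), add_zero, zero_add]
            · exact indicator_le_self' (fun _ _ => zero_le) _
            · rintro (hh | hh)
              · exact h1 hh.1
              · exact h3 hh.2
        · have hT : q ∉ T := fun hh => hh.elim h1 h2
          rw [indicator_of_notMem (fun hh => hT hh.1), indicator_of_notMem (s := M')]
          · simp
          · rintro (hh | hh)
            · exact h1 hh.1
            · exact hT hh.1
      have h3 : content cell w (A N) + ∑' q : D (N + 1), w q
          ≤ content cell w (A N) + (content cell w (A (N + 1)) +
            ∑ n ∈ Finset.range (N + 1 + 1), e n) := by
        calc content cell w (A N) + ∑' q : D (N + 1), w q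
            ≤ ∑' q : M', w q + ∑' q : maxCells cell lev T, w q :=
              add_le_add (content_le hcov) (ENNReal.tsum_mono_subtype _ hM)
          _ ≤ ∑' q : D N, w q + ∑' q : C (N + 1), w q := by rw [add_comm]; exact hsum
          _ ≤ (content cell w (A N) + ∑ n ∈ Finset.range (N + 1), e n) +
              (content cell w (A (N + 1)) + e (N + 1)) := add_le_add ih (hC2 _).le
          _ = _ := by rw [Finset.sum_range_succ _ (N + 1)]; ring
      exact (ENNReal.add_le_add_iff_left (hfin N)).1 h3
  let Dinf := maxCells cell lev (⋃ n, C n)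
  have hcov : (⋃ n, A n) ⊆ ⋃ q ∈ Dinf, cell q := by
    intro x hx
    obtain ⟨n, hn⟩ := mem_iUnion.1 hx
    have h1 := hC1 n hn
    simp only [mem_iUnion, exists_prop] at h1 ⊢
    obtain ⟨p0, hp0, hxp0⟩ := h1
    exact mem_maxCells_cover (mem_iUnion.2 ⟨n, hp0⟩) hxp0
  refine (content_le hcov).trans ?_
  rw [ENNReal.tsum_eq_iSup_sum]
  refine iSup_le fun F => ?_
  have : ∀ q : Dinf, ∃ n, (q : ι) ∈ C n := fun q => mem_iUnion.1 q.2.1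
  choose lv hlv using this
  let N := F.sup lv
  have hF : ∀ q ∈ F, (q : ι) ∈ D N := by
    intro q hq
    refine ⟨hCS (Finset.le_sup hq) (hlv q), ?_⟩
    rintro ⟨p, hp, hh⟩
    refine q.2.2 ⟨p, ?_, hh⟩
    simp only [S, mem_iUnion] at hp ⊢
    obtain ⟨i, _, hp⟩ := hp
    exact ⟨i, hp⟩
  calc ∑ q ∈ F, w q = ∑ q ∈ F.map ⟨Subtype.val, Subtype.val_injective⟩, w q := by simp
    _ ≤ ∑' q : D N, w q := by
      rw [tsum_subtype]
      refine le_trans (le_of_eq ?_) (ENNReal.sum_le_tsum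
        (F.map ⟨Subtype.val, Subtype.val_injective⟩))
      refine Finset.sum_congr rfl fun q hq => ?_
      rw [indicator_of_mem]
      obtain ⟨q', hq', rfl⟩ := Finset.mem_map.1 hq
      exact hF q' hq'
    _ ≤ c + ε := (key N).trans (add_le_add (h N) ((ENNReal.sum_le_tsum _).trans hes.le))

end Content
section Choquet

/-- Sequences bounded by `m` in the first `k` coordinates. -/
def bdd (m : ℕ → ℕ) (k : ℕ) : Set (ℕ → ℕ) := {σ | ∀ i < k, σ i ≤ m i}

lemma exists_bound {X : Type*} (H : OuterMeasure X)
    (hinc : ∀ A : ℕ → Set X, Monotone A → ∀ c : ℝ≥0∞, c ≠ ∞ → (∀ n, H (A n) ≤ c) →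
      H (⋃ n, A n) ≤ c)
    (f : (ℕ → ℕ) → X) {c : ℝ≥0∞} (hc : c ≠ ∞) (h : c < H (range f)) :
    ∃ m : ℕ → ℕ, ∀ k, c < H (f '' bdd m k) := by
  have step : ∀ k (m : ℕ → ℕ), c < H (f '' bdd m k) →
      ∃ j, c < H (f '' bdd (Function.update m k j) (k + 1)) := by
    intro k m hm
    by_contra! hcon
    have := hinc (fun j => f '' bdd (Function.update m k j) (k + 1)) ?_ c hc hcon
    · refine absurd (hm.trans_le (le_trans (measure_mono ?_) this)) (lt_irrefl _)
      rintro _ ⟨σ, hσ, rfl⟩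
      refine mem_iUnion.2 ⟨σ k, σ, ?_, rfl⟩
      intro i hi
      rcases eq_or_ne i k with rfl | hne
      · simp
      · rw [Function.update_of_ne hne]
        exact hσ i (by omega)
    · intro a b hab
      refine image_mono ?_
      intro σ hσ i hi
      have := hσ i hi
      rcases eq_or_ne i k with rfl | hne
      · simp only [Function.update_self] at this ⊢
        omega
      · rwa [Function.update_of_ne hne] at this ⊢
  choose! j hj using step
  let M : ℕ → ℕ → ℕ := fun k => Nat.rec (fun _ => 0) (fun k m => Function.update m k (j k m)) k
  have hM : ∀ k, M (k + 1) = Function.update (M k) k (j k (M k)) := fun k => rfl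
  have hP : ∀ k, c < H (f '' bdd (M k) k) := by
    intro k
    induction k with
    | zero =>
      have : bdd (M 0) 0 = univ := by ext; simp [bdd]
      rw [this, image_univ]; exact h
    | succ k ih => exact hj k _ ih
  refine ⟨fun i => M (i + 1) i, fun k => ?_⟩
  have hst : ∀ k, ∀ i < k, M k i = M (i + 1) i := by
    intro k i hi
    induction k with
    | zero => omega
    | succ k ih =>
      rcases eq_or_ne i k with rfl | hne
      · rfl
      · rw [hM, Function.update_of_ne hne]
        exact ih (by omega)
  have : bdd (fun i => M (i + 1) i) k = bdd (M k) k := by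
    ext σ
    exact forall₂_congr fun i hi => by rw [hst k i hi]
  rw [this]
  exact hP k

lemma isCompact_bddAll (m : ℕ → ℕ) : IsCompact {σ : ℕ → ℕ | ∀ i, σ i ≤ m i} := by
  have : {σ : ℕ → ℕ | ∀ i, σ i ≤ m i} = pi univ fun i => Iic (m i) := by ext; simp [Pi.le_def]
  rw [this]
  exact isCompact_univ_pi fun i => (finite_Iic (m i)).isCompact

lemma exists_bdd_subset {X : Type*} [TopologicalSpace X] {f : (ℕ → ℕ) → X} (hf : Continuous f)
    {m : ℕ → ℕ} {U : Set X} (hU : IsOpen U) (h : f '' {σ : ℕ → ℕ | ∀ i, σ i ≤ m i} ⊆ U) :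
    ∃ k, f '' bdd m k ⊆ U := by
  by_contra! hcon
  have : ∀ k, ∃ σ ∈ bdd m k, f σ ∉ U := by
    intro k
    have := hcon k
    rw [not_subset] at this
    obtain ⟨_, ⟨σ, hσ, rfl⟩, hn⟩ := this
    exact ⟨σ, hσ, hn⟩
  choose σ hσ hn using this
  obtain ⟨τ, hτ, φ, hφ, hlim⟩ := (isCompact_bddAll m).tendsto_subseq
    (x := fun k i => min (σ k i) (m i)) (fun k i => min_le_right _ _)
  have hlim2 : Tendsto (fun n => σ (φ n)) atTop (𝓝 τ) := by
    rw [tendsto_pi_nhds] at hlim ⊢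
    intro i
    refine (hlim i).congr' ?_
    filter_upwards [eventually_gt_atTop i] with n hn
    exact min_eq_left (hσ (φ n) i (hn.trans_le (hφ.id_le n)))
  have h1 : f τ ∈ U := h ⟨τ, hτ, rfl⟩
  have h2 := ((hf.tendsto τ).comp hlim2).eventually (hU.mem_nhds h1)
  obtain ⟨n, hn'⟩ := h2.exists
  exact hn _ hn'

end Choquet
section Dyadic

/-- The plane. -/
abbrev Pl := EuclideanSpace ℝ (Fin 2)

/-- Index of the dyadic square of side `2⁻ⁿ` containing `x`. -/
noncomputable def code (n : ℕ) (x : Pl) : ℤ × ℤ := (⌊2 ^ n * x 0⌋, ⌊2 ^ n * x 1⌋)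

/-- Dyadic square. -/
def dcell (q : ℕ × (ℤ × ℤ)) : Set Pl := {x | code q.1 x = q.2}

/-- Weight of the dyadic squares of level `n`. -/
noncomputable def wt (s : ℝ) (n : ℕ) : ℝ≥0∞ := ((2 : ℝ≥0∞)⁻¹ ^ n) ^ s

lemma floor_half (y : ℝ) (n : ℕ) : ⌊2 ^ n * y⌋ = ⌊2 ^ (n + 1) * y⌋ / 2 := by
  have h := Int.floor_div_natCast (2 ^ (n + 1) * y) 2
  rw [show ((2 : ℕ) : ℤ) = 2 by rfl] at h
  rw [← h]
  congr 1
  push_cast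
  ring

lemma code_par (n : ℕ) (x : Pl) :
    code n x = ((code (n + 1) x).1 / 2, (code (n + 1) x).2 / 2) := by
  simp only [code]
  rw [floor_half, floor_half (x 1)]

lemma code_eq_of_le {n n' : ℕ} (h : n ≤ n') {x y : Pl} (hxy : code n' x = code n' y) :
    code n x = code n y := by
  induction h with
  | refl => exact hxy
  | step _ ih => exact ih (by rw [code_par, hxy, ← code_par])

/-- Children. -/
def ch (k : ℤ × ℤ) : Finset (ℤ × ℤ) := {2 * k.1, 2 * k.1 + 1} ×ˢ {2 * k.2, 2 * k.2 + 1}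

lemma code_mem_ch (n : ℕ) (x : Pl) : code (n + 1) x ∈ ch (code n x) := by
  rw [code_par n x]
  simp only [ch, Finset.mem_product, Finset.mem_insert, Finset.mem_singleton]
  omega

/-- Neighbours. -/
noncomputable def nb (k : ℤ × ℤ) : Finset (ℤ × ℤ) :=
  Finset.Icc (k.1 - 1) (k.1 + 1) ×ˢ Finset.Icc (k.2 - 1) (k.2 + 1)

lemma card_nb (k : ℤ × ℤ) : (nb k).card = 9 := by
  simp only [nb, Finset.card_product, Int.card_Icc]
  have h1 : k.1 + 1 + 1 - (k.1 - 1) = 3 := by ring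
  have h2 : k.2 + 1 + 1 - (k.2 - 1) = 3 := by ring
  rw [h1, h2]; rfl

lemma abs_coord_le (x y : Pl) (i : Fin 2) : |x i - y i| ≤ dist x y := by
  rw [dist_eq_norm]
  have := PiLp.norm_apply_le (x - y) i
  simpa using this

lemma floor_near {n : ℕ} {a b : ℝ} (h : |a - b| < 2⁻¹ ^ n) :
    ⌊2 ^ n * a⌋ ∈ Finset.Icc (⌊2 ^ n * b⌋ - 1) (⌊2 ^ n * b⌋ + 1) := by
  have h2 : (0 : ℝ) < 2 ^ n := by positivity
  have h3 : |2 ^ n * a - 2 ^ n * b| < 1 := by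
    rw [← mul_sub, abs_mul, abs_of_pos h2]
    calc (2 : ℝ) ^ n * |a - b| < 2 ^ n * 2⁻¹ ^ n := by gcongr
      _ = 1 := by rw [← mul_pow]; norm_num
  rw [abs_lt] at h3
  rw [Finset.mem_Icc]
  constructor
  · have : ⌊2 ^ n * b⌋ - 1 ≤ ⌊2 ^ n * a⌋ := by
      rw [Int.le_floor]; push_cast
      have := Int.floor_le (2 ^ n * b); linarith [h3.1]
    exact this
  · have : ⌊2 ^ n * a⌋ < ⌊2 ^ n * b⌋ + 2 := by
      rw [Int.floor_lt]; push_cast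
      have := Int.lt_floor_add_one (2 ^ n * b); linarith [h3.2]
    omega

lemma code_near {n : ℕ} {x y : Pl} (h : dist y x < 2⁻¹ ^ n) : code n y ∈ nb (code n x) := by
  simp only [nb, Finset.mem_product]
  exact ⟨floor_near ((abs_coord_le y x 0).trans_lt h), floor_near ((abs_coord_le y x 1).trans_lt h)⟩

lemma measurableSet_dcell (q : ℕ × (ℤ × ℤ)) : MeasurableSet (dcell q) := by
  have : Measurable (code q.1) := by
    unfold code
    fun_prop
  exact this (measurableSet_singleton q.2)

lemma dcell_lam (p q : ℕ × (ℤ × ℤ)) (x : Pl) (hp : x ∈ dcell p) (hq : x ∈ dcell q)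
    (h : p.1 ≤ q.1) : p = q ∨ (p.1 < q.1 ∧ dcell q ⊆ dcell p) := by
  rcases h.eq_or_lt with h1 | h1
  · left
    refine Prod.ext h1 ?_
    rw [← (show code p.1 x = p.2 from hp), ← (show code q.1 x = q.2 from hq), h1]
  · right
    refine ⟨h1, fun y hy => ?_⟩
    have h2 : code q.1 y = code q.1 x := (show code q.1 y = q.2 from hy).trans (Eq.symm hq)
    exact (code_eq_of_le h h2).trans hp

lemma abs_sub_of_floor {n : ℕ} {a b : ℝ} (h : ⌊2 ^ n * a⌋ = ⌊2 ^ n * b⌋) : |a - b| ≤ 2⁻¹ ^ n := by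
  have h1 := Int.abs_sub_lt_one_of_floor_eq_floor h
  have h2 : (0 : ℝ) < 2 ^ n := by positivity
  rw [← mul_sub, abs_mul, abs_of_pos h2] at h1
  rw [inv_pow, ← one_div, le_div_iff₀ h2]
  linarith

lemma ediam_dcell (q : ℕ × (ℤ × ℤ)) : Metric.ediam (dcell q) ≤ 2 * 2⁻¹ ^ q.1 := by
  refine Metric.ediam_le fun x hx y hy => ?_
  have h : code q.1 x = code q.1 y := (show code q.1 x = q.2 from hx).trans (Eq.symm hy)
  simp only [code, Prod.mk.injEq] at h
  have h0 := abs_sub_of_floor h.1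
  have h1 := abs_sub_of_floor h.2
  have h2 : dist x y ≤ 2 * 2⁻¹ ^ q.1 := by
    rw [EuclideanSpace.dist_eq, Fin.sum_univ_two, Real.dist_eq, Real.dist_eq]
    refine Real.sqrt_le_iff.2 ⟨by positivity, ?_⟩
    nlinarith [abs_nonneg (x 0 - y 0), abs_nonneg (x 1 - y 1)]
  rw [edist_dist]
  refine (ENNReal.ofReal_le_ofReal h2).trans (le_of_eq ?_)
  rw [ENNReal.ofReal_mul (by norm_num), ENNReal.ofReal_pow (by norm_num),
    ENNReal.ofReal_inv_of_pos (by norm_num)]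
  norm_num

/-- Dyadic content. -/
noncomputable def H (s : ℝ) : OuterMeasure Pl :=
  content dcell (fun q : ℕ × (ℤ × ℤ) => wt s q.1)

lemma H_inc (s : ℝ) (A : ℕ → Set Pl) (hA : Monotone A) (c : ℝ≥0∞) (hc : c ≠ ∞)
    (h : ∀ n, H s (A n) ≤ c) : H s (⋃ n, A n) ≤ c :=
  content_iUnion_le (lev := Prod.fst) dcell_lam hA hc h

lemma H_cell (s : ℝ) (q : ℕ × (ℤ × ℤ)) : H s (dcell q) ≤ wt s q.1 :=
  content_cell_le (cell := dcell) (w := fun q : ℕ × (ℤ × ℤ) => wt s q.1) q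

lemma H_block (s : ℝ) (q : ℕ × (ℤ × ℤ)) :
    H s (Metric.thickening (2⁻¹ ^ q.1) (dcell q)) ≤ 9 * wt s q.1 := by
  have : Metric.thickening (2⁻¹ ^ q.1) (dcell q) ⊆ ⋃ k ∈ nb q.2, dcell (q.1, k) := by
    intro y hy
    obtain ⟨x, hx, hxy⟩ := Metric.mem_thickening_iff.1 hy
    simp only [mem_iUnion, exists_prop]
    refine ⟨code q.1 y, ?_, rfl⟩
    rw [← (show code q.1 x = q.2 from hx)]
    exact code_near hxy
  refine (measure_mono this).trans ((measure_biUnion_finset_le _ _).trans ?_)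
  refine (Finset.sum_le_card_nsmul _ _ (wt s q.1) fun k _ => H_cell s (q.1, k)).trans ?_
  rw [card_nb]; simp

lemma hausdorff_zero {s : ℝ} (hs : 0 < s) {A : Set Pl} (h : H s A = 0) : μH[s] A = 0 := by
  have : ∀ n : ℕ, ∃ C : Set (ℕ × (ℤ × ℤ)), A ⊆ (⋃ q ∈ C, dcell q) ∧
      ∑' q : C, wt s q.1.1 < ((n : ℝ≥0∞) + 1)⁻¹ := fun n =>
    exists_cover (cell := dcell) (w := fun q : ℕ × (ℤ × ℤ) => wt s q.1)
      (lt_of_eq_of_lt h (by simp))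
  choose C hC1 hC2 using this
  have hlim0 : Tendsto (fun n : ℕ => ((n : ℝ≥0∞) + 1)⁻¹) atTop (𝓝 0) := by
    have := (tendsto_add_atTop_iff_nat 1).2 ENNReal.tendsto_inv_nat_nhds_zero
    simpa using this
  have hb := Measure.hausdorffMeasure_le_liminf_tsum (β := ℕ) (ι := fun n => C n) s A (l := atTop)
    (fun n => 2 * (((n : ℝ≥0∞) + 1)⁻¹) ^ (s⁻¹)) ?_ (fun n q => dcell q.1) ?_ ?_
  · refine le_antisymm (hb.trans ?_) bot_le
    have h2 : Tendsto (fun n : ℕ => (2 : ℝ≥0∞) ^ s * ((n : ℝ≥0∞) + 1)⁻¹) atTop (𝓝 0) := by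
      have := ENNReal.Tendsto.const_mul (a := (2 : ℝ≥0∞) ^ s) hlim0 (Or.inr (by
        exact ENNReal.rpow_ne_top_of_nonneg hs.le (by simp)))
      simpa using this
    rw [← h2.liminf_eq]
    refine liminf_le_liminf (Eventually.of_forall fun n => ?_)
    calc ∑' q : C n, Metric.ediam (dcell q.1) ^ s
        ≤ ∑' q : C n, 2 ^ s * wt s q.1.1 := by
          refine ENNReal.tsum_le_tsum fun q => ?_
          rw [wt, ← ENNReal.mul_rpow_of_nonneg _ _ hs.le]
          exact ENNReal.rpow_le_rpow (ediam_dcell _) hs.le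
      _ = 2 ^ s * ∑' q : C n, wt s q.1.1 := ENNReal.tsum_mul_left
      _ ≤ _ := by gcongr; exact (hC2 n).le
  · have h1 := (ENNReal.continuous_rpow_const (y := s⁻¹)).tendsto 0
    rw [ENNReal.zero_rpow_of_pos (by positivity)] at h1
    have := ENNReal.Tendsto.const_mul (a := (2 : ℝ≥0∞)) (h1.comp hlim0) (Or.inr (by simp))
    simpa using this
  · refine Eventually.of_forall fun n q => (ediam_dcell _).trans ?_
    gcongr
    rw [ENNReal.le_rpow_inv_iff hs]
    exact (ENNReal.le_tsum q).trans (hC2 n).le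
  · refine Eventually.of_forall fun n => ?_
    refine (hC1 n).trans (le_of_eq ?_)
    rw [biUnion_eq_iUnion]

lemma split_sum {ι : Type*} (t : Finset ι) (a : ι → ℝ≥0∞) (m : ℝ≥0∞) (h : m ≤ ∑ i ∈ t, a i) :
    ∃ b : ι → ℝ≥0∞, (∀ i ∈ t, b i ≤ a i) ∧ ∑ i ∈ t, b i = m := by
  classical
  induction t using Finset.induction_on generalizing m with
  | empty => exact ⟨fun _ => 0, by simp, by simpa [eq_comm] using h⟩
  | insert i t hi ih =>
    rw [Finset.sum_insert hi] at h
    obtain ⟨b, hb1, hb2⟩ := ih (m - a i) (tsub_le_iff_left.2 h)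
    refine ⟨Function.update b i (min m (a i)), ?_, ?_⟩
    · intro j hj
      rcases eq_or_ne j i with rfl | hne
      · simp
      · rw [Function.update_of_ne hne]
        exact hb1 j (Finset.mem_of_mem_insert_of_ne hj hne)
    · rw [Finset.sum_insert hi, Function.update_self,
        Finset.sum_congr rfl (g := b) (fun j hj => Function.update_of_ne
          (fun h : j = i => hi (h ▸ hj)) _ _), hb2]
      rcases le_total m (a i) with h1 | h1
      · rw [min_eq_left h1, tsub_eq_zero_of_le h1, add_zero]
      · rw [min_eq_right h1, add_tsub_cancel_of_le h1]

lemma tree (s : ℝ) (A : Set Pl) : ∀ (j n : ℕ) (k : ℤ × ℤ) (m : ℝ≥0∞), m ≤ H s (A ∩ dcell (n, k)) →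
    ∃ μ : Measure Pl, μ univ = m ∧ μ (A ∩ dcell (n, k))ᶜ = 0 ∧
      ∀ n' k', n ≤ n' → n' ≤ n + j → μ (dcell (n', k')) ≤ wt s n' := by
  intro j
  induction j with
  | zero =>
    intro n k m hm
    rcases (A ∩ dcell (n, k)).eq_empty_or_nonempty with he | ⟨x, hx⟩
    · rw [he] at hm
      have : m = 0 := by simpa using hm
      exact ⟨0, by simp [this], by simp, by simp⟩
    · refine ⟨m • Measure.dirac x, by simp, ?_, ?_⟩
      · rw [Measure.smul_apply, Measure.dirac_apply, indicator_of_notMem (by simpa using hx)]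
        simp
      · intro n' k' h1 h2
        obtain rfl : n' = n := by omega
        refine (measure_mono (subset_univ _)).trans ?_
        have : (m • Measure.dirac x) univ = m := by simp
        rw [this]
        exact hm.trans ((measure_mono inter_subset_right).trans (H_cell s _))
  | succ j ih =>
    intro n k m hm
    have h1 : m ≤ ∑ k' ∈ ch k, H s (A ∩ dcell (n + 1, k')) := by
      refine hm.trans ((measure_mono ?_).trans (measure_biUnion_finset_le _ _))
      rintro x ⟨hxA, hx⟩
      simp only [mem_iUnion, exists_prop]
      refine ⟨code (n + 1) x, ?_, hxA, rfl⟩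
      rw [← (show code n x = k from hx)]
      exact code_mem_ch n x
    obtain ⟨b, hb1, hb2⟩ := split_sum _ _ _ h1
    have : ∀ k', ∃ μ : Measure Pl, k' ∈ ch k → (μ univ = b k' ∧
        μ (A ∩ dcell (n + 1, k'))ᶜ = 0 ∧
        ∀ n' k'', n + 1 ≤ n' → n' ≤ n + 1 + j → μ (dcell (n', k'')) ≤ wt s n') := by
      intro k'
      by_cases hk : k' ∈ ch k
      · obtain ⟨μ, hμ⟩ := ih (n + 1) k' (b k') (hb1 k' hk)
        exact ⟨μ, fun _ => hμ⟩
      · exact ⟨0, fun h => absurd h hk⟩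
    choose μ hμ using this
    have hcoe : ∀ S, (∑ k' ∈ ch k, μ k') S = ∑ k' ∈ ch k, μ k' S := fun S => by
      rw [Measure.finsetSum_apply]
    have hmass : (∑ k' ∈ ch k, μ k') univ = m := by
      rw [hcoe, ← hb2]
      exact Finset.sum_congr rfl fun k' hk => (hμ k' hk).1
    refine ⟨∑ k' ∈ ch k, μ k', hmass, ?_, ?_⟩
    · rw [hcoe]
      refine Finset.sum_eq_zero fun k' hk => measure_mono_null ?_ (hμ k' hk).2.1
      refine compl_subset_compl.2 ?_
      rintro x ⟨hxA, hx⟩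
      refine ⟨hxA, ?_⟩
      change code n x = k
      rw [code_par, show code (n + 1) x = k' from hx]
      simp only [ch, Finset.mem_product, Finset.mem_insert, Finset.mem_singleton] at hk
      ext <;> simp <;> omega
    · intro n' k'' h2 h3
      rcases h2.eq_or_lt with rfl | h2
      · refine (measure_mono (subset_univ _)).trans ?_
        rw [hmass]
        exact hm.trans ((measure_mono inter_subset_right).trans (H_cell s _))
      · rcases (dcell (n', k'')).eq_empty_or_nonempty with he | ⟨x, hx⟩
        · rw [he]; simp
        · have hz : ∀ k' ∈ ch k, k' ≠ code (n + 1) x → μ k' (dcell (n', k'')) = 0 := by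
            intro k' hk hne
            refine measure_mono_null ?_ (hμ k' hk).2.1
            rintro y hy ⟨_, hy'⟩
            apply hne
            rw [← (show code (n + 1) y = k' from hy')]
            exact code_eq_of_le h2 ((show code n' y = k'' from hy).trans (Eq.symm hx))
          rw [hcoe]
          by_cases hmem : code (n + 1) x ∈ ch k
          · rw [Finset.sum_eq_single_of_mem _ hmem fun k' hk hne => hz k' hk hne]
            exact (hμ _ hmem).2.2 _ _ h2 (by omega)
          · rw [Finset.sum_eq_zero fun k' hk => hz k' hk fun h => hmem (h ▸ hk)]
            exact zero_le

end Dyadic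
section Frostman

lemma exists_compact {s : ℝ} {F : Set Pl} (hF : MeasurableSet F) (h0 : H s F ≠ 0)
    (htop : H s F ≠ ∞) : ∃ K ⊆ F, IsCompact K ∧ H s K ≠ 0 := by
  have han := hF.analyticSet
  rw [AnalyticSet] at han
  rcases han with rfl | ⟨f, hf, hr⟩
  · simp at h0
  have hlt : H s F / 2 < H s (range f) := by rw [hr]; exact ENNReal.half_lt_self h0 htop
  have hc : H s F / 2 ≠ ∞ := hlt.ne_top
  obtain ⟨m, hm⟩ := exists_bound (H s) (H_inc s) f hc hlt
  refine ⟨f '' {σ | ∀ i, σ i ≤ m i}, ?_, (isCompact_bddAll m).image hf, fun hK => ?_⟩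
  · rw [← hr]; exact image_subset_range _ _
  have hpos : 0 < H s F / 2 / 9 := by
    refine ENNReal.div_pos ?_ (by simp)
    exact (ENNReal.div_pos h0 (by simp)).ne'
  obtain ⟨C, hC1, hC2⟩ := exists_cover (cell := dcell) (w := fun q : ℕ × (ℤ × ℤ) => wt s q.1)
      (lt_of_eq_of_lt hK hpos)
  let U : Set Pl := ⋃ q ∈ C, Metric.thickening (2⁻¹ ^ q.1) (dcell q)
  have hU : IsOpen U := isOpen_biUnion fun q _ => Metric.isOpen_thickening
  have hKU : f '' {σ | ∀ i, σ i ≤ m i} ⊆ U := hC1.trans (iUnion₂_mono fun q _ =>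
    Metric.self_subset_thickening (by positivity) _)
  obtain ⟨k, hk⟩ := exists_bdd_subset hf hU hKU
  refine absurd (hm k) (not_lt.2 ?_)
  calc H s (f '' bdd m k) ≤ H s U := measure_mono hk
    _ ≤ ∑' q : C, H s (Metric.thickening (2⁻¹ ^ q.1.1) (dcell q.1)) :=
        measure_biUnion_le _ (to_countable C) _
    _ ≤ ∑' q : C, 9 * wt s q.1.1 := ENNReal.tsum_le_tsum fun q => H_block s q.1
    _ = 9 * ∑' q : C, wt s q.1.1 := ENNReal.tsum_mul_left
    _ ≤ 9 * (H s F / 2 / 9) := by gcongr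
    _ = H s F / 2 := ENNReal.mul_div_cancel (by simp) (by simp)

lemma ball_subset (n : ℕ) (x : Pl) :
    Metric.ball x (2⁻¹ ^ n) ⊆ ⋃ k ∈ nb (code n x), dcell (n, k) := by
  intro y hy
  simp only [mem_iUnion, exists_prop]
  exact ⟨code n y, code_near hy, rfl⟩

theorem frostman {s : ℝ≥0} (hs : 0 < s) {E : Set Pl} (hE : MeasurableSet E)
    (h : (s : ℝ≥0∞) < dimH E) :
    ∃ μ : Measure Pl, IsProbabilityMeasure μ ∧ μ Eᶜ = 0 ∧ ∃ C : ℝ≥0∞, C ≠ ∞ ∧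
      ∀ x n, μ (Metric.ball x (2⁻¹ ^ n)) ≤ C * wt s n := by
  have hEU : E = ⋃ k, E ∩ dcell (0, k) := by
    rw [← inter_iUnion]
    refine (inter_eq_left.2 fun x _ => mem_iUnion.2 ⟨code 0 x, rfl⟩).symm
  rw [hEU, dimH_iUnion] at h
  obtain ⟨k, hk⟩ := lt_iSup_iff.1 h
  have hF : MeasurableSet (E ∩ dcell (0, k)) := hE.inter (measurableSet_dcell _)
  have hF0 : H s (E ∩ dcell (0, k)) ≠ 0 := by
    intro h0
    have h1 := hausdorffMeasure_of_lt_dimH hk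
    rw [hausdorff_zero (by exact_mod_cast hs) h0] at h1
    simp at h1
  have hcell : H s (dcell (0, k)) ≤ 1 := (H_cell s _).trans (by simp [wt])
  obtain ⟨K, hKF, hK, hK0⟩ := exists_compact hF hF0
    (((measure_mono inter_subset_right).trans hcell).trans_lt (by simp)).ne
  have hKc : K ∩ dcell (0, k) = K := inter_eq_left.2 (hKF.trans inter_subset_right)
  set m := H s K with hm
  have hmtop : m ≠ ∞ := by
    refine ((measure_mono ?_).trans hcell |>.trans_lt (by simp)).ne
    exact hKF.trans inter_subset_right
  have hT : ∀ N : ℕ, ∃ μ : ProbabilityMeasure Pl, (μ : Measure Pl) Kᶜ = 0 ∧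
      ∀ n k', n ≤ N → (μ : Measure Pl) (dcell (n, k')) ≤ m⁻¹ * wt s n := by
    intro N
    obtain ⟨μ, h1, h2, h3⟩ := tree s K N 0 k m (by rw [hKc])
    refine ⟨⟨m⁻¹ • μ, ⟨?_⟩⟩, ?_, ?_⟩
    · rw [Measure.smul_apply, h1, smul_eq_mul, ENNReal.inv_mul_cancel hK0 hmtop]
    · rw [hKc] at h2
      simp [h2]
    · intro n k' hn
      have := h3 n k' (Nat.zero_le _) (by omega)
      change (m⁻¹ • μ) _ ≤ _
      rw [Measure.smul_apply, smul_eq_mul]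
      gcongr
  choose μs hμ1 hμ2 using hT
  have hcomp := isCompact_setOfPred_probabilityMeasure_mass_eq_compl_isCompact_le (E := Pl)
    (u := fun _ => 0) (K := fun _ => K) tendsto_const_nhds (fun _ => hK) (Or.inl inferInstance)
  obtain ⟨μ, hμmem, hle⟩ := isCompact_iff_ultrafilter_le_nhds'.1 hcomp
    ((hyperfilter ℕ).map μs) (by
      rw [Ultrafilter.mem_map]
      refine Filter.univ_mem' fun N => ?_
      intro _
      have := hμ1 N
      rw [← ProbabilityMeasure.ennreal_coeFn_eq_coeFn_toMeasure] at this
      exact_mod_cast this.le)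
  have hlim : Tendsto μs (hyperfilter ℕ : Filter ℕ) (𝓝 μ) := hle
  refine ⟨μ, inferInstance, ?_, 9 * m⁻¹, ?_, ?_⟩
  · refine measure_mono_null (compl_subset_compl.2 (hKF.trans inter_subset_left)) ?_
    rw [← ProbabilityMeasure.ennreal_coeFn_eq_coeFn_toMeasure]
    have := hμmem 0
    simpa using this
  · exact ENNReal.mul_ne_top (by simp) (by simpa using hK0)
  · intro x n
    refine (ProbabilityMeasure.le_liminf_measure_open_of_tendsto hlim Metric.isOpen_ball).trans ?_
    refine liminf_le_of_frequently_le' (Eventually.frequently ?_)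
    have hev : ∀ᶠ N in (hyperfilter ℕ : Filter ℕ), n ≤ N :=
      Nat.hyperfilter_le_atTop (eventually_ge_atTop n)
    filter_upwards [hev] with N hN
    refine (measure_mono (ball_subset n x)).trans ((measure_biUnion_finset_le _ _).trans ?_)
    refine (Finset.sum_le_card_nsmul _ _ (m⁻¹ * wt s n) fun k _ => hμ2 N n k hN).trans ?_
    rw [card_nb]; simp [mul_assoc]

end Frostman
section Energy

lemma potential_bound {X : Type*} [MetricSpace X] [MeasurableSpace X] [OpensMeasurableSpace X]
    {s t : ℝ≥0} (ht : 0 < t) (hts : t < s) {μ : Measure X}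
    [IsFiniteMeasure μ] {C : ℝ≥0∞} (hC : C ≠ ∞)
    (h : ∀ x n, μ (Metric.ball x (2⁻¹ ^ n)) ≤ C * wt s n) :
    ∃ B : ℝ≥0∞, B ≠ ∞ ∧ ∀ x, ∫⁻ y, edist x y ^ (-(t : ℝ)) ∂μ ≤ B := by
  have ht' : (0 : ℝ) < t := by exact_mod_cast ht
  have hts' : (t : ℝ) < s := by exact_mod_cast hts
  let a : ℕ → ℝ≥0∞ := fun n => ((2 : ℝ≥0∞) ^ (n + 2)) ^ (t : ℝ)
  have ha1 : ∀ n, 1 ≤ a n := fun n =>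
    ENNReal.one_le_rpow (one_le_pow₀ (by norm_num)) ht'
  have hpt : ∀ x y : X, edist x y ^ (-(t : ℝ)) ≤
      1 + ∑' n, (Metric.ball x (2⁻¹ ^ n)).indicator (fun _ => a n) y := by
    intro x y
    rcases eq_or_ne x y with rfl | hne
    · have : ∑' n, (Metric.ball x (2⁻¹ ^ n)).indicator (fun _ => a n) x = ∞ := by
        refine top_unique ?_
        rw [← ENNReal.tsum_const_eq_top_of_ne_zero (α := ℕ) (c := 1) one_ne_zero]
        refine ENNReal.tsum_le_tsum fun n => ?_
        rw [indicator_of_mem (Metric.mem_ball_self (by positivity))]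
        exact ha1 n
      rw [this]; simp
    · rcases le_or_gt 1 (dist x y) with h1 | h1
      · refine le_trans ?_ le_self_add
        rw [ENNReal.rpow_neg]
        refine ENNReal.inv_le_one.2 (ENNReal.one_le_rpow ?_ ht')
        rw [edist_dist]
        exact ENNReal.one_le_ofReal.2 h1
      · obtain ⟨n, hn1, hn2⟩ := exists_nat_pow_near_of_lt_one (dist_pos.2 hne) h1.le
          (show (0 : ℝ) < 2⁻¹ by norm_num) (by norm_num)
        have hmem : y ∈ Metric.ball x (2⁻¹ ^ (n - 1)) := by
          rw [Metric.mem_ball, dist_comm]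
          rcases n with _ | n
          · simpa using h1
          · refine hn2.trans_lt ?_
            rw [Nat.add_sub_cancel, pow_succ]
            have : (0 : ℝ) < 2⁻¹ ^ n := by positivity
            linarith
        refine le_trans ?_ (le_add_self)
        refine le_trans ?_ (ENNReal.le_tsum (n - 1))
        rw [indicator_of_mem hmem, ENNReal.rpow_neg, ← ENNReal.inv_rpow]
        refine ENNReal.rpow_le_rpow ?_ ht'.le
        rw [ENNReal.inv_le_iff_inv_le, ENNReal.inv_pow, edist_dist]
        have h3 : (2⁻¹ : ℝ≥0∞) ^ (n - 1 + 2) = ENNReal.ofReal (2⁻¹ ^ (n - 1 + 2)) := by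
          rw [ENNReal.ofReal_pow (by norm_num), ENNReal.ofReal_inv_of_pos (by norm_num)]
          norm_num
        rw [h3]
        refine ENNReal.ofReal_le_ofReal (le_trans ?_ hn1.le)
        exact pow_le_pow_of_le_one (by norm_num) (by norm_num) (by omega)
  have hr : (2 : ℝ≥0∞) ^ (t : ℝ) * 2⁻¹ ^ (s : ℝ) < 1 := by
    rw [ENNReal.inv_rpow, ← ENNReal.rpow_neg, ← ENNReal.rpow_add _ _ (by simp) (by simp)]
    exact ENNReal.rpow_lt_one_of_one_lt_of_neg (by norm_num) (by linarith)
  have hterm : ∀ n, a n * (C * wt s n) =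
      ((2 : ℝ≥0∞) ^ 2) ^ (t : ℝ) * C * ((2 : ℝ≥0∞) ^ (t : ℝ) * 2⁻¹ ^ (s : ℝ)) ^ n := by
    intro n
    have e1 : a n = ((2 : ℝ≥0∞) ^ (t : ℝ)) ^ n * ((2 : ℝ≥0∞) ^ 2) ^ (t : ℝ) := by
      simp only [a]
      rw [pow_add, ENNReal.mul_rpow_of_nonneg _ _ ht'.le]
      congr 1
      rw [← ENNReal.rpow_natCast, ← ENNReal.rpow_natCast, ← ENNReal.rpow_mul, ← ENNReal.rpow_mul,
        mul_comm]
    have e2 : wt s n = ((2⁻¹ : ℝ≥0∞) ^ (s : ℝ)) ^ n := by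
      rw [wt, ← ENNReal.rpow_natCast, ← ENNReal.rpow_natCast, ← ENNReal.rpow_mul,
        ← ENNReal.rpow_mul, mul_comm]
    rw [e1, e2, mul_pow]
    ring
  refine ⟨μ univ + ∑' n, a n * (C * wt s n), ?_, fun x => ?_⟩
  · refine ENNReal.add_ne_top.2 ⟨measure_ne_top _ _, ?_⟩
    simp_rw [hterm]
    rw [ENNReal.tsum_mul_left, ENNReal.tsum_geometric]
    refine ENNReal.mul_ne_top (ENNReal.mul_ne_top ?_ hC) ?_
    · exact ENNReal.rpow_ne_top_of_nonneg ht'.le (by simp)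
    · exact ENNReal.inv_ne_top.2 (tsub_pos_of_lt hr).ne'
  · calc ∫⁻ y, edist x y ^ (-(t : ℝ)) ∂μ
        ≤ ∫⁻ y, (1 + ∑' n, (Metric.ball x (2⁻¹ ^ n)).indicator (fun _ => a n) y) ∂μ :=
          lintegral_mono (hpt x)
      _ = μ univ + ∑' n, a n * μ (Metric.ball x (2⁻¹ ^ n)) := by
          rw [lintegral_add_left measurable_const, lintegral_tsum]
          · simp [lintegral_indicator_const Metric.isOpen_ball.measurableSet]
          · intro n
            exact (measurable_const.indicator Metric.isOpen_ball.measurableSet).aemeasurable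
      _ ≤ _ := by gcongr; exact h _ _

lemma real_potential {t : ℝ≥0} (ht : 0 < t) (ht1 : t < 1) :
    ∃ B : ℝ≥0∞, B ≠ ∞ ∧ ∀ z : ℝ,
      ∫⁻ u in Icc 0 (2 * Real.pi), edist z u ^ (-(t : ℝ)) ≤ B := by
  refine potential_bound (s := 1) (C := 2) ht ht1 (by simp) fun x n => ?_
  refine (Measure.restrict_apply_le _ _).trans ?_
  rw [Real.volume_ball, ENNReal.ofReal_mul (by norm_num), ENNReal.ofReal_pow (by norm_num),
    ENNReal.ofReal_inv_of_pos (by norm_num)]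
  simp [wt]

lemma cos_lower {u : ℝ} (h1 : -Real.pi ≤ u) (h2 : u ≤ 3 * Real.pi) :
    ∃ j : Fin 4, 2 / Real.pi * |u - (-(Real.pi / 2) + j * Real.pi)| ≤ |Real.cos u| := by
  have hpi := Real.pi_pos
  have key : ∃ j : Fin 4, |u - (-(Real.pi / 2) + j * Real.pi)| ≤ Real.pi / 2 := by
    rcases le_or_gt u 0 with h | h
    · refine ⟨0, abs_le.2 ⟨?_, ?_⟩⟩ <;> simp <;> linarith
    rcases le_or_gt u Real.pi with h' | h'
    · refine ⟨1, abs_le.2 ⟨?_, ?_⟩⟩ <;> simp <;> linarith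
    rcases le_or_gt u (2 * Real.pi) with h'' | h''
    · refine ⟨2, abs_le.2 ⟨?_, ?_⟩⟩ <;> simp <;> linarith
    · refine ⟨3, abs_le.2 ⟨?_, ?_⟩⟩ <;> simp <;> linarith
  obtain ⟨j, hj⟩ := key
  refine ⟨j, (Real.mul_abs_le_abs_sin hj).trans (le_of_eq ?_)⟩
  have e : u - (-(Real.pi / 2) + (j : ℕ) * Real.pi) = u + Real.pi / 2 - (j : ℕ) * Real.pi := by ring
  rw [e, Real.sin_sub_nat_mul_pi, Real.sin_add_pi_div_two, abs_mul, abs_pow]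
  simp

lemma proj_sub (θ : ℝ) (x y : Pl) : ∃ α ∈ Ioc (-Real.pi) Real.pi, ∀ θ : ℝ,
    proj θ x - proj θ y = dist x y * Real.cos (θ - α) := by
  let z : ℂ := ⟨x 0 - y 0, x 1 - y 1⟩
  refine ⟨z.arg, Complex.arg_mem_Ioc z, fun θ => ?_⟩
  have hz : ‖z‖ = dist x y := by
    rw [EuclideanSpace.dist_eq, Fin.sum_univ_two, Real.dist_eq, Real.dist_eq, sq_abs, sq_abs,
      Complex.norm_eq_sqrt_sq_add_sq]
  have h1 := Complex.norm_mul_cos_arg z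
  have h2 := Complex.norm_mul_sin_arg z
  rw [hz] at h1 h2
  rw [Real.cos_sub]
  calc proj θ x - proj θ y = z.re * Real.cos θ + z.im * Real.sin θ := by simp only [proj, z]; ring
    _ = _ := by rw [← h1, ← h2]; ring

lemma angle_bound {t : ℝ≥0} (ht : 0 < t) (ht1 : t < 1) :
    ∃ B : ℝ≥0∞, B ≠ ∞ ∧ ∀ x y : Pl,
      ∫⁻ θ in Icc 0 (2 * Real.pi), edist (proj θ x) (proj θ y) ^ (-(t : ℝ))
        ≤ B * edist x y ^ (-(t : ℝ)) := by
  have ht' : (0 : ℝ) < t := by exact_mod_cast ht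
  have hpi := Real.pi_pos
  obtain ⟨B, hB, hB2⟩ := real_potential ht ht1
  let b : ℝ≥0∞ := ENNReal.ofReal (2 / Real.pi) ^ (-(t : ℝ))
  have hb : b ≠ ∞ := by
    simp only [b, ENNReal.rpow_neg]
    refine ENNReal.inv_ne_top.2 ?_
    exact (ENNReal.rpow_pos (by rw [ENNReal.ofReal_pos]; positivity) (by simp)).ne'
  refine ⟨1 + 4 * (b * B), ?_, fun x y => ?_⟩
  · exact ENNReal.add_ne_top.2 ⟨by simp, ENNReal.mul_ne_top (by simp) (ENNReal.mul_ne_top hb hB)⟩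
  rcases eq_or_ne x y with rfl | hne
  · have : (0 : ℝ≥0∞) ^ (-(t : ℝ)) = ∞ := ENNReal.zero_rpow_of_neg (by linarith)
    rw [edist_self, this, ENNReal.mul_top (by simp)]
    exact le_top
  obtain ⟨α, hα, hp⟩ := proj_sub 0 x y
  let z : Fin 4 → ℝ := fun j => α + (-(Real.pi / 2) + j * Real.pi)
  have hpt : ∀ θ ∈ Icc 0 (2 * Real.pi), edist (proj θ x) (proj θ y) ^ (-(t : ℝ)) ≤
      ∑ j, (edist x y ^ (-(t : ℝ)) * b) * edist (z j) θ ^ (-(t : ℝ)) := by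
    intro θ hθ
    obtain ⟨j, hj⟩ := cos_lower (u := θ - α) (by linarith [hα.2, hθ.1]) (by linarith [hα.1, hθ.2])
    refine le_trans ?_ (Finset.single_le_sum (f := fun j =>
      (edist x y ^ (-(t : ℝ)) * b) * edist (z j) θ ^ (-(t : ℝ))) (fun _ _ => zero_le)
      (Finset.mem_univ j))
    simp only [b]
    rw [← ENNReal.mul_rpow_of_ne_top (edist_ne_top _ _) (by simp),
      ← ENNReal.mul_rpow_of_ne_top (ENNReal.mul_ne_top (edist_ne_top _ _) (by simp))
        (edist_ne_top _ _)]
    rw [ENNReal.rpow_neg, ENNReal.rpow_neg, ENNReal.inv_le_inv]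
    refine ENNReal.rpow_le_rpow ?_ ht'.le
    rw [edist_dist, edist_dist, edist_dist, ← ENNReal.ofReal_mul dist_nonneg,
      ← ENNReal.ofReal_mul (by positivity)]
    refine ENNReal.ofReal_le_ofReal ?_
    rw [Real.dist_eq (proj θ x), hp θ, abs_mul, abs_of_nonneg dist_nonneg, mul_assoc]
    refine mul_le_mul_of_nonneg_left ?_ dist_nonneg
    refine le_trans (le_of_eq ?_) hj
    rw [dist_comm, Real.dist_eq]
    congr 2
    simp only [z]; ring
  calc ∫⁻ θ in Icc 0 (2 * Real.pi), edist (proj θ x) (proj θ y) ^ (-(t : ℝ))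
      ≤ ∫⁻ θ in Icc 0 (2 * Real.pi),
          ∑ j, (edist x y ^ (-(t : ℝ)) * b) * edist (z j) θ ^ (-(t : ℝ)) :=
        setLIntegral_mono' measurableSet_Icc hpt
    _ = ∑ j, (edist x y ^ (-(t : ℝ)) * b) *
          ∫⁻ θ in Icc 0 (2 * Real.pi), edist (z j) θ ^ (-(t : ℝ)) := by
        rw [lintegral_finsetSum]
        · refine Finset.sum_congr rfl fun j _ => ?_
          rw [lintegral_const_mul]
          fun_prop
        · intro j _
          fun_prop
    _ ≤ ∑ j : Fin 4, (edist x y ^ (-(t : ℝ)) * b) * B := by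
        gcongr with j; exact hB2 _
    _ = 4 * (b * B) * edist x y ^ (-(t : ℝ)) := by
        rw [Finset.sum_const, Finset.card_univ, Fintype.card_fin, nsmul_eq_mul]
        push_cast; ring
    _ ≤ _ := by gcongr; exact le_add_self

lemma le_dimH_of_energy {t : ℝ≥0} (ht : 0 < t) {μ : Measure Pl} [IsProbabilityMeasure μ]
    {E : Set Pl} (hE : μ Eᶜ = 0) {g : Pl → ℝ} (hg : Continuous g)
    (h : ∫⁻ x, ∫⁻ y, edist (g x) (g y) ^ (-(t : ℝ)) ∂μ ∂μ ≠ ∞) :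
    (t : ℝ≥0∞) ≤ dimH (g '' E) := by
  have ht' : (0 : ℝ) < t := by exact_mod_cast ht
  have hgm := hg.measurable
  let P : Pl → ℝ≥0∞ := fun x => ∫⁻ y, edist (g x) (g y) ^ (-(t : ℝ)) ∂μ
  have hP : Measurable P := by
    refine Measurable.lintegral_prod_right' (f := fun p : Pl × Pl =>
      edist (g p.1) (g p.2) ^ (-(t : ℝ))) ?_
    fun_prop
  have hfin : ∀ᵐ x ∂μ, P x < ∞ := ae_lt_top hP h
  obtain ⟨M, hM⟩ : ∃ M : ℕ, μ {x | P x ≤ M} ≠ 0 := by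
    by_contra! hcon
    have h1 : μ (⋃ M : ℕ, {x | P x ≤ M}) = 0 := measure_iUnion_null hcon
    have h2 : ∀ᵐ x ∂μ, x ∈ ⋃ M : ℕ, {x | P x ≤ M} := by
      filter_upwards [hfin] with x hx
      obtain ⟨n, hn⟩ := ENNReal.exists_nat_gt hx.ne
      exact mem_iUnion.2 ⟨n, hn.le⟩
    have h3 : ∀ᵐ x ∂μ, False := by
      filter_upwards [h2, measure_eq_zero_iff_ae_notMem.1 h1] with x hx hx'
      exact hx' hx
    simp at h3
    exact IsProbabilityMeasure.ne_zero μ h3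
  set F := {x | P x ≤ M} with hF
  have hFm : MeasurableSet F := measurableSet_le hP measurable_const
  let m : ℝ≥0∞ := M + 1
  have hm0 : m ≠ 0 := by simp [m]
  have hmt : m ≠ ∞ := by simp [m]
  let ν : Measure ℝ := m⁻¹ • Measure.map g (μ.restrict F)
  have hν : ν ≤ μH[(t : ℝ)] := by
    refine Measure.le_hausdorffMeasure _ _ 1 one_pos fun S hS => ?_
    refine (measure_mono (subset_closure (s := S))).trans ?_
    rw [← Metric.ediam_closure] at hS ⊢
    have hcl : MeasurableSet (closure S) := isClosed_closure.measurableSet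
    simp only [ν, Measure.smul_apply, smul_eq_mul]
    rw [Measure.map_apply hgm hcl, Measure.restrict_apply (hgm hcl)]
    rw [ENNReal.inv_mul_le_iff hm0 hmt]
    rcases (g ⁻¹' closure S ∩ F).eq_empty_or_nonempty with he | ⟨x0, hx0, hx0F⟩
    · rw [he]; simp
    set d := Metric.ediam (closure S) with hd
    have h1 : d ^ (-(t : ℝ)) * μ (g ⁻¹' closure S) ≤ m := by
      calc d ^ (-(t : ℝ)) * μ (g ⁻¹' closure S)
          = ∫⁻ y in g ⁻¹' closure S, d ^ (-(t : ℝ)) ∂μ := by rw [setLIntegral_const]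
        _ ≤ ∫⁻ y in g ⁻¹' closure S, edist (g x0) (g y) ^ (-(t : ℝ)) ∂μ := by
            refine setLIntegral_mono' (hgm hcl) fun y hy => ?_
            rw [ENNReal.rpow_neg, ENNReal.rpow_neg, ENNReal.inv_le_inv]
            exact ENNReal.rpow_le_rpow (Metric.edist_le_ediam_of_mem hx0 hy) ht'.le
        _ ≤ P x0 := setLIntegral_le_lintegral _ _
        _ ≤ m := le_trans hx0F le_self_add
    refine (measure_mono inter_subset_left).trans ?_
    rcases eq_or_ne d 0 with h0 | h0
    · have h2 : d ^ (-(t : ℝ)) = ∞ := by rw [h0]; exact ENNReal.zero_rpow_of_neg (by linarith)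
      rw [h2] at h1
      have : μ (g ⁻¹' closure S) = 0 := by
        by_contra hne
        rw [ENNReal.top_mul hne] at h1
        exact hmt (top_unique h1)
      rw [this]; exact zero_le
    · have hdt : d ≠ ∞ := (hS.trans_lt (by simp)).ne
      rw [ENNReal.rpow_neg, ENNReal.inv_mul_le_iff
        (ENNReal.rpow_pos (pos_iff_ne_zero.2 h0) hdt).ne'
        (ENNReal.rpow_ne_top_of_nonneg ht'.le hdt)] at h1
      rwa [mul_comm]
  refine le_dimH_of_hausdorffMeasure_ne_zero fun h0 => ?_
  have h1 : ν (g '' E) = 0 := le_antisymm ((hν _).trans h0.le) bot_le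
  simp only [ν, Measure.smul_apply, smul_eq_mul, mul_eq_zero, ENNReal.inv_eq_zero, hmt,
    false_or] at h1
  have h2 : μ.restrict F E = 0 := by
    refine le_antisymm ?_ bot_le
    rw [← h1]
    exact (measure_mono (subset_preimage_image g E)).trans
      (Measure.le_map_apply hgm.aemeasurable _)
  have h3 : μ.restrict F Eᶜ = 0 := le_antisymm ((Measure.restrict_apply_le _ _).trans hE.le) bot_le
  have h4 : μ.restrict F univ = 0 := by
    rw [← union_compl_self E]
    exact measure_union_null h2 h3
  rw [Measure.restrict_apply_univ] at h4
  exact hM h4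

lemma continuous_proj (θ : ℝ) : Continuous (proj θ) := by
  unfold proj; fun_prop

lemma ae_le_dimH {E : Set Pl} (hE : MeasurableSet E) {t : ℝ≥0} (h : (t : ℝ≥0∞) < min (dimH E) 1) :
    ∀ᵐ θ ∂(volume.restrict (Icc (0:ℝ) (2 * Real.pi))), (t : ℝ≥0∞) ≤ dimH (proj θ '' E) := by
  rcases eq_or_ne t 0 with rfl | h0
  · simp
  have ht : 0 < t := pos_iff_ne_zero.2 h0
  have ht1 : t < 1 := by exact_mod_cast h.trans_le (min_le_right _ _)
  obtain ⟨s, hts, hsE⟩ := ENNReal.lt_iff_exists_nnreal_btwn.1 (h.trans_le (min_le_left _ _))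
  have hts : t < s := by exact_mod_cast hts
  obtain ⟨μ, hμ, hμE, C, hC, hball⟩ := frostman (ht.trans hts) hE hsE
  obtain ⟨B1, hB1, hpot⟩ := potential_bound ht hts hC hball
  obtain ⟨B2, hB2, hang⟩ := angle_bound ht ht1
  set lam := volume.restrict (Icc (0:ℝ) (2 * Real.pi)) with hlam
  have hmeas : Measurable fun p : ℝ × Pl × Pl =>
      edist (proj p.1 p.2.1) (proj p.1 p.2.2) ^ (-(t : ℝ)) := by
    unfold proj; fun_prop
  have hmeas2 : Measurable fun p : (ℝ × Pl) × Pl =>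
      edist (proj p.1.1 p.1.2) (proj p.1.1 p.2) ^ (-(t : ℝ)) := by
    unfold proj; fun_prop
  have hI : Measurable fun p : ℝ × Pl =>
      ∫⁻ y, edist (proj p.1 p.2) (proj p.1 y) ^ (-(t : ℝ)) ∂μ := hmeas2.lintegral_prod_right'
  have hbound : ∫⁻ θ, ∫⁻ x, ∫⁻ y, edist (proj θ x) (proj θ y) ^ (-(t : ℝ)) ∂μ ∂μ ∂lam ≠ ∞ := by
    rw [lintegral_lintegral_swap hI.aemeasurable]
    have h1 : ∀ x, ∫⁻ θ, ∫⁻ y, edist (proj θ x) (proj θ y) ^ (-(t : ℝ)) ∂μ ∂lam ≤ B2 * B1 := by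
      intro x
      rw [lintegral_lintegral_swap]
      · calc ∫⁻ y, ∫⁻ θ, edist (proj θ x) (proj θ y) ^ (-(t : ℝ)) ∂lam ∂μ
            ≤ ∫⁻ y, B2 * edist x y ^ (-(t : ℝ)) ∂μ := lintegral_mono fun y => hang x y
          _ = B2 * ∫⁻ y, edist x y ^ (-(t : ℝ)) ∂μ := lintegral_const_mul' _ _ hB2
          _ ≤ B2 * B1 := by gcongr; exact hpot x
      · have : Measurable fun p : ℝ × Pl =>
            edist (proj p.1 x) (proj p.1 p.2) ^ (-(t : ℝ)) := by
          unfold proj; fun_prop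
        exact this.aemeasurable
    refine ((lintegral_mono h1).trans_lt ?_).ne
    rw [lintegral_const, measure_univ, mul_one]
    exact ENNReal.mul_lt_top hB2.lt_top hB1.lt_top
  have hae := ae_lt_top hI.lintegral_prod_right' hbound
  filter_upwards [hae] with θ hθ
  exact le_dimH_of_energy ht hμE (continuous_proj θ) hθ.ne

lemma lipschitz_proj (θ : ℝ) : LipschitzWith 1 (proj θ) := by
  refine LipschitzWith.of_dist_le_mul fun x y => ?_
  obtain ⟨α, _, hp⟩ := proj_sub 0 x y
  rw [Real.dist_eq, hp θ, abs_mul, abs_of_nonneg dist_nonneg]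
  simp only [NNReal.coe_one, one_mul]
  exact mul_le_of_le_one_right dist_nonneg (Real.abs_cos_le_one _)

end Energy

end Marstrand

/-- Marstrand's projection theorem: for a.e. θ ∈ [0, 2π], the Hausdorff
dimension of π_θ E equals min(dim_H E, 1). -/
theorem marstrand_projection (E : Set (EuclideanSpace ℝ (Fin 2)))
    (hE : MeasurableSet E) :
    ∀ᵐ θ ∂(volume.restrict (Set.Icc (0:ℝ) (2 * Real.pi))),
      dimH (proj θ '' E) = min (dimH E) 1 := by
  have h : ∀ q : ℚ, ∀ᵐ θ ∂(volume.restrict (Set.Icc (0:ℝ) (2 * Real.pi))),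
      ((Real.toNNReal q : ℝ≥0) : ℝ≥0∞) < min (dimH E) 1 →
        ((Real.toNNReal q : ℝ≥0) : ℝ≥0∞) ≤ dimH (proj θ '' E) := by
    intro q
    by_cases hq : ((Real.toNNReal q : ℝ≥0) : ℝ≥0∞) < min (dimH E) 1
    · filter_upwards [Marstrand.ae_le_dimH hE hq] with θ hθ _
      exact hθ
    · exact Eventually.of_forall fun θ h => absurd h hq
  filter_upwards [ae_all_iff.2 h] with θ hθ
  refine le_antisymm (le_min ?_ ?_) ?_
  · exact (Marstrand.lipschitz_proj θ).dimH_image_le E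
  · exact (dimH_mono (subset_univ _)).trans Real.dimH_univ.le
  · refine le_of_forall_lt fun c hc => ?_
    obtain ⟨q, _, h1, h2⟩ := ENNReal.lt_iff_exists_rat_btwn.1 hc
    exact h1.trans_le (hθ q h2)
end
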